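/- Assume θ̇ has compact support and the tube is twisted. Then inf_{s ∈ [0,∞)} μ(s) > 1/4, i.e. the constant γ := inf_{s≥0} μ(s) − 1/4 appearing in the improved heat-semigroup decay rate is strictly positive. -/

import Mathlib

open MeasureTheory Real Set Filter

noncomputable section

/-- First partial derivative ∂₁ of a function on ℝ³ = ℝ × ℝ × ℝ. -/
def pd1 {E : Type*} [NormedAddCommGroup E] [NormedSpace ℝ E]
    (ψ : ℝ × ℝ × ℝ → E) (x : ℝ × ℝ × ℝ) : E :=
  deriv (fun t => ψ (t, x.2.1, x.2.2)) x.1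

/-- Second partial derivative ∂₂. -/
def pd2 {E : Type*} [NormedAddCommGroup E] [NormedSpace ℝ E]
    (ψ : ℝ × ℝ × ℝ → E) (x : ℝ × ℝ × ℝ) : E :=
  deriv (fun t => ψ (x.1, t, x.2.2)) x.2.1

/-- Third partial derivative ∂₃. -/
def pd3 {E : Type*} [NormedAddCommGroup E] [NormedSpace ℝ E]
    (ψ : ℝ × ℝ × ℝ → E) (x : ℝ × ℝ × ℝ) : E :=
  deriv (fun t => ψ (x.1, x.2.1, t)) x.2.2

/-- Transverse angular derivative ∂_τ = x₃∂₂ − x₂∂₃. -/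
def pdtau {E : Type*} [NormedAddCommGroup E] [NormedSpace ℝ E]
    (ψ : ℝ × ℝ × ℝ → E) (x : ℝ × ℝ × ℝ) : E :=
  x.2.2 • pd2 ψ x - x.2.1 • pd3 ψ x

/-- The straight tube Ω₀ = ℝ × ω. -/
def Omega0 (ω : Set (ℝ × ℝ)) : Set (ℝ × ℝ × ℝ) := {x | x.2 ∈ ω}

/-- Smooth compactly supported test functions with support in Ω (i.e. C_c^∞(Ω)). -/
def IsTest3 {E : Type*} [NormedAddCommGroup E] [NormedSpace ℝ E]
    (Ω : Set (ℝ × ℝ × ℝ)) (ψ : ℝ × ℝ × ℝ → E) : Prop :=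
  ContDiff ℝ (⊤ : ℕ∞) ψ ∧ HasCompactSupport ψ ∧ tsupport ψ ⊆ Ω

/-- Partial derivatives on ℝ². -/
def pd1' (f : ℝ × ℝ → ℂ) (p : ℝ × ℝ) : ℂ := deriv (fun t => f (t, p.2)) p.1

def pd2' (f : ℝ × ℝ → ℂ) (p : ℝ × ℝ) : ℂ := deriv (fun t => f (p.1, t)) p.2

/-- Smooth compactly supported test functions on the cross-section, C_c^∞(ω). -/
def IsTest2 (ω : Set (ℝ × ℝ)) (f : ℝ × ℝ → ℂ) : Prop :=
  ContDiff ℝ (⊤ : ℕ∞) f ∧ HasCompactSupport f ∧ tsupport f ⊆ ω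

/-- The lowest Dirichlet eigenvalue E₁ of −Δ on ω, defined variationally. -/
def E1 (ω : Set (ℝ × ℝ)) : ℝ :=
  sInf { r : ℝ | ∃ f : ℝ × ℝ → ℂ, IsTest2 ω f ∧ f ≠ 0 ∧
    r = (∫ p in ω, (‖pd1' f p‖ ^ 2 + ‖pd2' f p‖ ^ 2)) / ∫ p in ω, ‖f p‖ ^ 2 }

/-- The twisted quadratic form Q_θ[ψ] = ∫_{Ω₀} (|∂₁ψ − θ̇ ∂_τψ|² + |∇'ψ|²). -/
def Qform (θ : ℝ → ℝ) (ω : Set (ℝ × ℝ)) (ψ : ℝ × ℝ × ℝ → ℂ) : ℝ :=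
  ∫ x in Omega0 ω,
    (‖pd1 ψ x - deriv θ x.1 • pdtau ψ x‖ ^ 2 + ‖pd2 ψ x‖ ^ 2 + ‖pd3 ψ x‖ ^ 2)

/-- Rotation of the plane by angle ϑ about the origin. -/
def rot (ϑ : ℝ) (p : ℝ × ℝ) : ℝ × ℝ :=
  (p.1 * Real.cos ϑ + p.2 * Real.sin ϑ, -p.1 * Real.sin ϑ + p.2 * Real.cos ϑ)

/-- The tube is twisted: θ is not constant and ω is not rotationally symmetric about
the origin (in the strong sense: some rotated copy of ω differs from ω on a set of
positive Lebesgue measure). -/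
def Twisted (θ : ℝ → ℝ) (ω : Set (ℝ × ℝ)) : Prop :=
  (∃ s t : ℝ, θ s ≠ θ t) ∧
  (∃ ϑ ∈ Set.Ioo (0 : ℝ) (2 * Real.pi), volume (symmDiff (rot ϑ '' ω) ω) ≠ 0)

/-- The tube is untwisted: θ is constant or ω is invariant under every rotation
about the origin. -/
def Untwisted (θ : ℝ → ℝ) (ω : Set (ℝ × ℝ)) : Prop :=
  (∀ s t : ℝ, θ s = θ t) ∨ (∀ ϑ : ℝ, rot ϑ '' ω = ω)

/-- σ_s(y₁) = e^{s/2} θ̇(e^{s/2} y₁). -/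
def sigmafun (θ : ℝ → ℝ) (s y₁ : ℝ) : ℝ :=
  Real.exp (s / 2) * deriv θ (Real.exp (s / 2) * y₁)

/-- The quadratic form J_s of the generator of the self-similar evolution:
J_s[v] = ∫|∂₁v − σ_s ∂_τv|² + (1/16)∫ y₁²|v|² + e^s ( ∫|∇'v|² − E₁∫|v|² ). -/
def Jform (θ : ℝ → ℝ) (ω : Set (ℝ × ℝ)) (s : ℝ) (v : ℝ × ℝ × ℝ → ℂ) : ℝ :=
  (∫ y in Omega0 ω, ‖pd1 v y - sigmafun θ s y.1 • pdtau v y‖ ^ 2)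
    + (1 / 16) * (∫ y in Omega0 ω, y.1 ^ 2 * ‖v y‖ ^ 2)
    + Real.exp s * ((∫ y in Omega0 ω, (‖pd2 v y‖ ^ 2 + ‖pd3 v y‖ ^ 2))
        - E1 ω * ∫ y in Omega0 ω, ‖v y‖ ^ 2)

/-- μ(s): the lowest point of the spectrum of the generator of the self-similar
evolution, defined variationally over nonzero v ∈ C_c^∞(Ω₀). -/
def mu (θ : ℝ → ℝ) (ω : Set (ℝ × ℝ)) (s : ℝ) : ℝ :=
  sInf { r : ℝ | ∃ v : ℝ × ℝ × ℝ → ℂ, IsTest3 (Omega0 ω) v ∧ v ≠ 0 ∧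
    r = Jform θ ω s v / ∫ y in Omega0 ω, ‖v y‖ ^ 2 }

open Topology

/-- Real-valued test functions on a planar domain. -/
def IsRealTest (ω : Set (ℝ × ℝ)) (h : ℝ × ℝ → ℝ) : Prop :=
  ContDiff ℝ (⊤ : ℕ∞) h ∧ HasCompactSupport h ∧ tsupport h ⊆ ω

/-- Squared Euclidean norm of the gradient of a function on the plane. -/
def gradSq (h : ℝ × ℝ → ℝ) (p : ℝ × ℝ) : ℝ :=
  (fderiv ℝ h p (1, 0)) ^ 2 + (fderiv ℝ h p (0, 1)) ^ 2

lemma gradSq_nonneg (h : ℝ × ℝ → ℝ) (p : ℝ × ℝ) : 0 ≤ gradSq h p := by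
  unfold gradSq; positivity

lemma continuous_fderiv_apply_of_smooth {h : ℝ × ℝ → ℝ} (hh : ContDiff ℝ (⊤ : ℕ∞) h)
    (v : ℝ × ℝ) : Continuous fun p => fderiv ℝ h p v :=
  (hh.continuous_fderiv (by simp)).clm_apply continuous_const

lemma continuous_gradSq {h : ℝ × ℝ → ℝ} (hh : ContDiff ℝ (⊤ : ℕ∞) h) :
    Continuous (gradSq h) :=
  ((continuous_fderiv_apply_of_smooth hh _).pow 2).add
    ((continuous_fderiv_apply_of_smooth hh _).pow 2)

lemma hasCompactSupport_gradSq {h : ℝ × ℝ → ℝ} (hh : HasCompactSupport h) :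
    HasCompactSupport (gradSq h) := by
  have := hh.fderiv (𝕜 := ℝ)
  refine this.mono ?_
  intro p hp h0
  apply hp
  simp [gradSq, h0]

namespace IsRealTest

variable {ω : Set (ℝ × ℝ)} {h η g : ℝ × ℝ → ℝ}

lemma continuous (hh : IsRealTest ω h) : Continuous h := hh.1.continuous

lemma integrable_gradSq (hh : IsRealTest ω h) : Integrable (gradSq h) :=
  (continuous_gradSq hh.1).integrable_of_hasCompactSupport (hasCompactSupport_gradSq hh.2.1)

lemma integrable_sq (hh : IsRealTest ω h) : Integrable (fun p => h p ^ 2) :=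
  (hh.continuous.pow 2).integrable_of_hasCompactSupport
    (hh.2.1.mono (fun p hp h0 => hp (by simp [h0])))

lemma add (hh : IsRealTest ω h) (hg : IsRealTest ω g) :
    IsRealTest ω (fun p => h p + g p) :=
  ⟨hh.1.add hg.1, hh.2.1.add hg.2.1,
    (tsupport_add h g).trans (union_subset hh.2.2 hg.2.2)⟩

lemma mul_smooth (hh : IsRealTest ω h) (hg : ContDiff ℝ (⊤ : ℕ∞) g) :
    IsRealTest ω (fun p => h p * g p) :=
  ⟨hh.1.mul hg, hh.2.1.mul_right, (tsupport_mul_subset_left (f := h) (g := g)).trans hh.2.2⟩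

lemma differentiableAt (hh : IsRealTest ω h) (p : ℝ × ℝ) : DifferentiableAt ℝ h p :=
  (hh.1.differentiable (by simp)) p

end IsRealTest

lemma fderiv_add_const_mul_sq_div {h η : ℝ × ℝ → ℝ} {p : ℝ × ℝ} {δ t : ℝ}
    (hh : DifferentiableAt ℝ h p) (hη : DifferentiableAt ℝ η p) (hd : h p + δ ≠ 0)
    (v : ℝ × ℝ) :
    fderiv ℝ (fun q => h q + η q * (t * η q * (h q + δ)⁻¹)) p v =
      fderiv ℝ h p v + t * (2 * η p * fderiv ℝ η p v / (h p + δ)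
        - η p ^ 2 * fderiv ℝ h p v / (h p + δ) ^ 2) := by
  have h1 := hh.hasFDerivAt
  have h2 := hη.hasFDerivAt
  have h3 := (hasDerivAt_inv hd).comp_hasFDerivAt p (h1.add_const δ)
  have h4 := h1.add (h2.mul ((h2.const_mul t).mul h3))
  have h5 : HasFDerivAt (fun q => h q + η q * (t * η q * (h q + δ)⁻¹)) _ p := h4
  rw [h5.fderiv]
  simp
  field_simp
  ring

lemma gradient_cross_bound {a b e H T t δ : ℝ} (hδ : 0 < δ) (hH : δ ≤ H) (ht : 0 < t)
    (he : |e| ≤ 1) (hT : T = a + t * (2 * e * b / H - e ^ 2 * a / H ^ 2)) :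
    T ^ 2 ≤ a ^ 2 + t * (4 * b ^ 2 - e ^ 2 * a ^ 2 / H ^ 2)
      + t ^ 2 * (8 / δ ^ 2 * b ^ 2 + 2 / δ ^ 4 * a ^ 2) := by
  have hHp : 0 < H := hδ.trans_le hH
  have he2 : e ^ 2 ≤ 1 := by rwa [sq_le_one_iff_abs_le_one]
  set x := e * a / H with hx
  set y := e * b / H with hy
  have e1 : 2 * e * b / H = 2 * y := by rw [hy]; ring
  have e2 : e ^ 2 * a / H ^ 2 = e * x / H := by rw [hx]; field_simp
  have e3 : e ^ 2 * a ^ 2 / H ^ 2 = x ^ 2 := by rw [hx]; field_simp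
  have e4 : a * (2 * y - e * x / H) = 2 * b * x - x ^ 2 := by
    rw [hx, hy]; field_simp
  have hinv : 1 / H ≤ 1 / δ := one_div_le_one_div_of_le hδ hH
  have hinv0 : 0 < 1 / H := by positivity
  have hi2 : (1 / H) ^ 2 ≤ (1 / δ) ^ 2 := by gcongr
  have hy2 : y ^ 2 ≤ (1 / δ) ^ 2 * b ^ 2 := by
    have : y ^ 2 = e ^ 2 * ((1 / H) ^ 2 * b ^ 2) := by rw [hy]; field_simp
    rw [this]
    calc e ^ 2 * ((1 / H) ^ 2 * b ^ 2) ≤ 1 * ((1 / δ) ^ 2 * b ^ 2) := by gcongr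
      _ = _ := one_mul _
  have hx2 : (e * x / H) ^ 2 ≤ (1 / δ) ^ 4 * a ^ 2 := by
    have : (e * x / H) ^ 2 = (e ^ 2) ^ 2 * ((1 / H) ^ 4 * a ^ 2) := by rw [hx]; field_simp
    rw [this]
    calc (e ^ 2) ^ 2 * ((1 / H) ^ 4 * a ^ 2) ≤ 1 ^ 2 * ((1 / δ) ^ 4 * a ^ 2) := by gcongr
      _ = _ := by ring
  rw [hT, e1, e2, e3]
  have f1 : 8 / δ ^ 2 * b ^ 2 = 8 * ((1 / δ) ^ 2 * b ^ 2) := by field_simp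
  have f2 : 2 / δ ^ 4 * a ^ 2 = 2 * ((1 / δ) ^ 4 * a ^ 2) := by field_simp
  rw [f1, f2]
  have k1 : (2 * y - e * x / H) ^ 2 ≤ 8 * y ^ 2 + 2 * (e * x / H) ^ 2 := by
    nlinarith [sq_nonneg (2 * y + e * x / H)]
  have k2 : (a + t * (2 * y - e * x / H)) ^ 2
      = a ^ 2 + t * (2 * (a * (2 * y - e * x / H))) + t ^ 2 * (2 * y - e * x / H) ^ 2 := by ring
  rw [k2, e4]
  have k3 : 2 * (2 * b * x - x ^ 2) ≤ 4 * b ^ 2 - x ^ 2 := by nlinarith [sq_nonneg (2 * b - x)]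
  have k4 : (2 * y - e * x / H) ^ 2
      ≤ 8 * ((1 / δ) ^ 2 * b ^ 2) + 2 * ((1 / δ) ^ 4 * a ^ 2) := by linarith
  gcongr

/-- Caccioppoli-type estimate for the logarithm of an almost-minimiser of the Rayleigh quotient. -/
lemma log_energy_bound {ω : Set (ℝ × ℝ)} {E : ℝ} (hE0 : 0 ≤ E)
    (hE : ∀ g, IsRealTest ω g → E * ∫ p, g p ^ 2 ≤ ∫ p, gradSq g p)
    {h η : ℝ × ℝ → ℝ} (hh : IsRealTest ω h) (hpos : ∀ p, 0 ≤ h p) (hη : IsRealTest ω η)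
    (hη1 : ∀ p, |η p| ≤ 1) {δ t : ℝ} (hδ : 0 < δ) (ht : 0 < t) :
    ∫ p, η p ^ 2 * gradSq h p / (h p + δ) ^ 2 ≤
      4 * (∫ p, gradSq η p) + ((∫ p, gradSq h p) - E * ∫ p, h p ^ 2) / t
        + t * (8 / δ ^ 2 * (∫ p, gradSq η p) + 2 / δ ^ 4 * ∫ p, gradSq h p) := by
  have hd : ∀ p, 0 < h p + δ := fun p => by linarith [hpos p]
  have hsm : ContDiff ℝ (⊤ : ℕ∞) fun q => (t * η q * (h q + δ)⁻¹) :=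
    (contDiff_const.mul hη.1).mul ((hh.1.add contDiff_const).inv fun p => (hd p).ne')
  have hw : IsRealTest ω (fun q => h q + η q * (t * η q * (h q + δ)⁻¹)) :=
    hh.add (hη.mul_smooth hsm)
  have key := hE _ hw
  have hXc : Continuous fun p => η p ^ 2 * gradSq h p / (h p + δ) ^ 2 :=
    ((hη.continuous.pow 2).mul (continuous_gradSq hh.1)).div
      ((hh.continuous.add continuous_const).pow 2) (fun p => by have := hd p; positivity)
  have hX : Integrable fun p => η p ^ 2 * gradSq h p / (h p + δ) ^ 2 :=
    hXc.integrable_of_hasCompactSupport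
      (hη.2.1.mono (fun p hp h0 => hp (by simp [h0])))
  have ih := hh.integrable_gradSq
  have iη := hη.integrable_gradSq
  have i1 : Integrable fun p =>
      t * (4 * gradSq η p - η p ^ 2 * gradSq h p / (h p + δ) ^ 2) :=
    ((iη.const_mul 4).sub hX).const_mul t
  have i2 : Integrable fun p => gradSq h p
      + t * (4 * gradSq η p - η p ^ 2 * gradSq h p / (h p + δ) ^ 2) := ih.add i1
  have i3 : Integrable fun p =>
      t ^ 2 * (8 / δ ^ 2 * gradSq η p + 2 / δ ^ 4 * gradSq h p) :=
    ((iη.const_mul _).add (ih.const_mul _)).const_mul _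
  have up : ∫ p, gradSq (fun q => h q + η q * (t * η q * (h q + δ)⁻¹)) p ≤
      ∫ p, (gradSq h p + t * (4 * gradSq η p - η p ^ 2 * gradSq h p / (h p + δ) ^ 2)
        + t ^ 2 * (8 / δ ^ 2 * gradSq η p + 2 / δ ^ 4 * gradSq h p)) := by
    refine integral_mono hw.integrable_gradSq (i2.add i3) ?_
    · intro p
      have c := fun v => gradient_cross_bound (a := fderiv ℝ h p v) (b := fderiv ℝ η p v)
        (e := η p) (H := h p + δ) hδ (by linarith [hpos p]) ht (hη1 p)
        (fderiv_add_const_mul_sq_div (t := t) (hh.differentiableAt p) (hη.differentiableAt p)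
          (hd p).ne' v)
      have c1 := c (1, 0)
      have c2 := c (0, 1)
      simp only [gradSq]
      refine (add_le_add c1 c2).trans (le_of_eq ?_)
      ring
  rw [integral_add i2 i3, integral_add ih i1, integral_const_mul,
    integral_const_mul, integral_sub (iη.const_mul 4) hX, integral_const_mul,
    integral_add (iη.const_mul _) (ih.const_mul _), integral_const_mul, integral_const_mul] at up
  have low : ∫ p, h p ^ 2 ≤ ∫ p, (h p + η p * (t * η p * (h p + δ)⁻¹)) ^ 2 := by
    refine integral_mono hh.integrable_sq hw.integrable_sq ?_
    intro p
    have h1 := hpos p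
    have h2 := hd p
    have : 0 ≤ η p * (t * η p * (h p + δ)⁻¹) := by
      have : η p * (t * η p * (h p + δ)⁻¹) = t * η p ^ 2 * (h p + δ)⁻¹ := by ring
      rw [this]; positivity
    simp only
    gcongr
    linarith
  have low' := mul_le_mul_of_nonneg_left low hE0
  set X := ∫ p, η p ^ 2 * gradSq h p / (h p + δ) ^ 2
  set A := ∫ p, gradSq h p
  set N := ∫ p, gradSq η p
  set S := ∫ p, h p ^ 2
  have : t * X ≤ t * (4 * N + (A - E * S) / t + t * (8 / δ ^ 2 * N + 2 / δ ^ 4 * A)) := by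
    have e : t * ((A - E * S) / t) = A - E * S := by field_simp
    nlinarith [e]
  exact le_of_mul_le_mul_left this ht

lemma sq_setIntegral_Icc_le {f : ℝ → ℝ} (hf : Continuous f) {a b : ℝ} (hab : a < b) :
    (∫ t in Icc a b, f t) ^ 2 ≤ (b - a) * ∫ t in Icc a b, f t ^ 2 := by
  have hi : ∀ g : ℝ → ℝ, Continuous g → IntegrableOn g (Icc a b) := fun g hg =>
    hg.continuousOn.integrableOn_Icc
  have hL : 0 < b - a := sub_pos.2 hab
  set m := (∫ t in Icc a b, f t) / (b - a) with hm
  have h0 : 0 ≤ ∫ t in Icc a b, (f t - m) ^ 2 := integral_nonneg fun t => sq_nonneg _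
  have e : ∫ t in Icc a b, (f t - m) ^ 2 =
      (∫ t in Icc a b, f t ^ 2) - 2 * m * (∫ t in Icc a b, f t) + (b - a) * m ^ 2 := by
    have i1 : IntegrableOn (fun t => f t ^ 2) (Icc a b) := hi _ (hf.pow 2)
    have i2 : IntegrableOn (fun t => 2 * m * f t) (Icc a b) := hi _ (by fun_prop)
    have i3 : IntegrableOn (fun _ : ℝ => m ^ 2) (Icc a b) := hi _ continuous_const
    have e1 : ∀ t, (f t - m) ^ 2 = f t ^ 2 - 2 * m * f t + m ^ 2 := fun t => by ring
    simp_rw [e1]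
    have i4 : IntegrableOn (fun t => f t ^ 2 - 2 * m * f t) (Icc a b) := i1.sub i2
    rw [integral_add i4 i3, integral_sub i1 i2, integral_const_mul, setIntegral_const]
    simp [measureReal_def, hL.le]
  have e2 : ∫ t in Icc a b, f t = m * (b - a) := by rw [hm]; field_simp
  rw [e, e2] at h0
  rw [e2]
  nlinarith

/-- One-dimensional oscillation estimate by the Dirichlet energy. -/
lemma norm_sub_sq_le {F : Type*} [NormedAddCommGroup F] [NormedSpace ℝ F] [CompleteSpace F]
    {φ φ' : ℝ → F} (hφ : ∀ t, HasDerivAt φ (φ' t) t) (hc : Continuous φ') {a b s t : ℝ}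
    (hs : s ∈ Icc a b) (ht : t ∈ Icc a b) :
    ‖φ s - φ t‖ ^ 2 ≤ (b - a) * ∫ r in Icc a b, ‖φ' r‖ ^ 2 := by
  rcases eq_or_lt_of_le (hs.1.trans hs.2) with h | hab
  · subst h
    have : s = t := le_antisymm (hs.2.trans ht.1) (ht.2.trans hs.1)
    simp [this]
  refine le_trans ?_ (sq_setIntegral_Icc_le hc.norm hab)
  have h1 : φ s - φ t = ∫ r in t..s, φ' r :=
    (intervalIntegral.integral_eq_sub_of_hasDerivAt (fun x _ => hφ x)
      (hc.intervalIntegrable _ _)).symm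
  have h2 : ‖φ s - φ t‖ ≤ ∫ r in Icc a b, ‖φ' r‖ := by
    rw [h1]
    refine (intervalIntegral.norm_integral_le_integral_norm_uIoc).trans ?_
    refine setIntegral_mono_set (hc.norm.continuousOn.integrableOn_Icc)
      (Eventually.of_forall fun r => norm_nonneg _) ?_
    refine (LE.le.eventuallyLE ?_)
    exact uIoc_subset_uIcc.trans (uIcc_subset_Icc ht hs)
  gcongr

lemma closedBall_prod_eq (x : ℝ × ℝ) (r : ℝ) :
    Metric.closedBall x r = Icc (x.1 - r) (x.1 + r) ×ˢ Icc (x.2 - r) (x.2 + r) := by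
  rw [← Real.closedBall_eq_Icc, ← Real.closedBall_eq_Icc, closedBall_prod_same]

/-- Two sets in a square on which a function differs by at least `d` cannot both be large
unless the function has large Dirichlet energy. -/
lemma measure_mul_measure_le_of_le_abs_sub {l : ℝ × ℝ → ℝ} (hl : ContDiff ℝ (⊤ : ℕ∞) l)
    {x : ℝ × ℝ} {r : ℝ} {S T : Set (ℝ × ℝ)} (hS : MeasurableSet S)
    (hT : MeasurableSet T) (hSQ : S ⊆ Metric.closedBall x r) (hTQ : T ⊆ Metric.closedBall x r)
    {d : ℝ} (hd : 0 ≤ d) (hdl : ∀ p ∈ S, ∀ q ∈ T, d ≤ |l p - l q|) :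
    d ^ 2 * (volume.real S * volume.real T) ≤
      2 * (2 * r) ^ 4 * ∫ p in Metric.closedBall x r, gradSq l p := by
  rcases lt_or_ge r 0 with hr | hr
  · have : Metric.closedBall x r = ∅ := Metric.closedBall_eq_empty.2 hr
    rw [this] at hSQ ⊢
    simp [subset_empty_iff.1 hSQ]
  set I := Icc (x.1 - r) (x.1 + r) with hI
  set I' := Icc (x.2 - r) (x.2 + r) with hI'
  have hQ : Metric.closedBall x r = I ×ˢ I' := closedBall_prod_eq x r
  set lx : ℝ × ℝ → ℝ := fun p => fderiv ℝ l p (1, 0) with hlx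
  set ly : ℝ × ℝ → ℝ := fun p => fderiv ℝ l p (0, 1) with hly
  have clx : Continuous lx := continuous_fderiv_apply_of_smooth hl _
  have cly : Continuous ly := continuous_fderiv_apply_of_smooth hl _
  set F : ℝ → ℝ := fun y => ∫ t in I, lx (t, y) ^ 2 with hF
  set G : ℝ → ℝ := fun u => ∫ t in I', ly (u, t) ^ 2 with hG
  have cF : Continuous F :=
    continuous_parametric_integral_of_continuous (μ := volume) (f := fun y t => lx (t, y) ^ 2)
      (by fun_prop) isCompact_Icc
  have cG : Continuous G :=
    continuous_parametric_integral_of_continuous (μ := volume) (f := fun u t => ly (u, t) ^ 2)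
      (by fun_prop) isCompact_Icc
  have F0 : ∀ y, 0 ≤ F y := fun y => integral_nonneg fun t => sq_nonneg _
  have G0 : ∀ y, 0 ≤ G y := fun y => integral_nonneg fun t => sq_nonneg _
  have hlen1 : x.1 + r - (x.1 - r) = 2 * r := by ring
  have hlen2 : x.2 + r - (x.2 - r) = 2 * r := by ring
  have pt : ∀ p ∈ S, ∀ q ∈ T, d ^ 2 ≤ 2 * (2 * r) * F p.2 + 2 * (2 * r) * G q.1 := by
    intro p hp q hq
    have hp' := hSQ hp
    have hq' := hTQ hq
    rw [hQ] at hp' hq'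
    have h1 : ∀ y t, HasDerivAt (fun t => l (t, y)) (lx (t, y)) t := by
      intro y t
      have := ((hl.differentiable (by simp)) (t, y)).hasFDerivAt.comp_hasDerivAt t
        ((hasDerivAt_id t).prodMk (hasDerivAt_const t y))
      exact this
    have h2 : ∀ u t, HasDerivAt (fun t => l (u, t)) (ly (u, t)) t := by
      intro u t
      have := ((hl.differentiable (by simp)) (u, t)).hasFDerivAt.comp_hasDerivAt t
        ((hasDerivAt_const t u).prodMk (hasDerivAt_id t))
      exact this
    have k1 := norm_sub_sq_le (h1 p.2) (by fun_prop) hp'.1 hq'.1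
    have k2 := norm_sub_sq_le (h2 q.1) (by fun_prop) hp'.2 hq'.2
    rw [hlen1] at k1
    rw [hlen2] at k2
    simp only [Real.norm_eq_abs, sq_abs] at k1 k2
    have k3 : d ^ 2 ≤ (l p - l q) ^ 2 := by
      rw [← sq_abs (l p - l q)]
      have := hdl p hp q hq
      gcongr
    have k4 : l p - l q = (l (p.1, p.2) - l (q.1, p.2)) + (l (q.1, p.2) - l (q.1, q.2)) := by
      simp
    have k5 : (l p - l q) ^ 2 ≤ 2 * (l (p.1, p.2) - l (q.1, p.2)) ^ 2
        + 2 * (l (q.1, p.2) - l (q.1, q.2)) ^ 2 := by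
      rw [k4]
      nlinarith [sq_nonneg ((l (p.1, p.2) - l (q.1, p.2)) - (l (q.1, p.2) - l (q.1, q.2)))]
    simp only [hF, hG]
    linarith
  have hQc : IsCompact (Metric.closedBall x r) := isCompact_closedBall x r
  have hQm : MeasurableSet (Metric.closedBall x r) := Metric.isClosed_closedBall.measurableSet
  have volQ : volume.real (Metric.closedBall x r) = (2 * r) * (2 * r) := by
    rw [hQ, measureReal_def, Measure.volume_eq_prod, Measure.prod_prod, ENNReal.toReal_mul]
    simp only [hI, hI', Real.volume_Icc, hlen1, hlen2]
    rw [ENNReal.toReal_ofReal (by positivity)]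
  have finQ : volume (Metric.closedBall x r) ≠ ⊤ := hQc.measure_ne_top
  have finS : volume S ≠ ⊤ := measure_ne_top_of_subset hSQ finQ
  have finT : volume T ≠ ⊤ := measure_ne_top_of_subset hTQ finQ
  have leS : volume.real S ≤ (2 * r) * (2 * r) := volQ ▸ measureReal_mono hSQ finQ
  have leT : volume.real T ≤ (2 * r) * (2 * r) := volQ ▸ measureReal_mono hTQ finQ
  have iF : IntegrableOn (fun p : ℝ × ℝ => F p.2) (Metric.closedBall x r) :=
    (cF.comp continuous_snd).continuousOn.integrableOn_compact hQc
  have iG : IntegrableOn (fun p : ℝ × ℝ => G p.1) (Metric.closedBall x r) :=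
    (cG.comp continuous_fst).continuousOn.integrableOn_compact hQc
  have ilx : IntegrableOn (fun p => lx p ^ 2) (Metric.closedBall x r) :=
    (clx.pow 2).continuousOn.integrableOn_compact hQc
  have ily : IntegrableOn (fun p => ly p ^ 2) (Metric.closedBall x r) :=
    (cly.pow 2).continuousOn.integrableOn_compact hQc
  have intF : ∫ p in Metric.closedBall x r, F p.2 =
      2 * r * ∫ p in Metric.closedBall x r, lx p ^ 2 := by
    rw [hQ] at iF ilx ⊢
    rw [Measure.volume_eq_prod] at iF ilx ⊢
    rw [setIntegral_prod _ iF, setIntegral_prod _ ilx]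
    simp only [setIntegral_const, smul_eq_mul]
    rw [hI, Real.volume_real_Icc_of_le (by linarith), hlen1, ← hI]
    congr 1
    simp only [hF]
    refine integral_integral_swap (f := fun y t => lx (t, y) ^ 2) ?_
    rw [IntegrableOn, ← Measure.prod_restrict] at ilx
    exact ilx.swap
  have intG : ∫ p in Metric.closedBall x r, G p.1 =
      2 * r * ∫ p in Metric.closedBall x r, ly p ^ 2 := by
    rw [hQ] at iG ily ⊢
    rw [Measure.volume_eq_prod] at iG ily ⊢
    rw [setIntegral_prod _ iG, setIntegral_prod _ ily]
    simp only [setIntegral_const, smul_eq_mul]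
    rw [hI', Real.volume_real_Icc_of_le (by linarith), hlen2, ← hI', integral_const_mul]
  have intg : ∫ p in Metric.closedBall x r, gradSq l p =
      (∫ p in Metric.closedBall x r, lx p ^ 2) + ∫ p in Metric.closedBall x r, ly p ^ 2 :=
    integral_add ilx ily
  set A := ∫ p in Metric.closedBall x r, lx p ^ 2
  set B := ∫ p in Metric.closedBall x r, ly p ^ 2
  have A0 : 0 ≤ A := integral_nonneg fun p => sq_nonneg _
  have B0 : 0 ≤ B := integral_nonneg fun p => sq_nonneg _
  have st1 : ∀ q ∈ T, d ^ 2 * volume.real S ≤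
      2 * (2 * r) * ((2 * r) * A + (2 * r) * (2 * r) * G q.1) := by
    intro q hq
    have i1 : IntegrableOn (fun p : ℝ × ℝ => 2 * (2 * r) * F p.2) S :=
      (iF.mono_set hSQ).const_mul _
    have i2 : IntegrableOn (fun _ : ℝ × ℝ => 2 * (2 * r) * G q.1) S :=
      integrableOn_const finS
    have h1 : ∫ _ in S, d ^ 2 ≤ ∫ p in S, (2 * (2 * r) * F p.2 + 2 * (2 * r) * G q.1) :=
      setIntegral_mono_on (integrableOn_const finS) (i1.add i2) hS
        (fun p hp => pt p hp q hq)
    rw [integral_add i1 i2, setIntegral_const, setIntegral_const, integral_const_mul] at h1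
    have h2 : ∫ p in S, F p.2 ≤ ∫ p in Metric.closedBall x r, F p.2 :=
      setIntegral_mono_set iF (Eventually.of_forall fun p => F0 _) (LE.le.eventuallyLE hSQ)
    rw [intF] at h2
    have h3 := mul_le_mul_of_nonneg_right leS (G0 q.1)
    simp only [smul_eq_mul] at h1
    nlinarith
  have i1 : IntegrableOn (fun _ : ℝ × ℝ => 2 * (2 * r) * ((2 * r) * A)) T :=
    integrableOn_const finT
  have i2 : IntegrableOn (fun q : ℝ × ℝ => 2 * (2 * r) * ((2 * r) * (2 * r)) * G q.1) T :=
    (iG.mono_set hTQ).const_mul _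
  have st2 : ∫ _ in T, d ^ 2 * volume.real S ≤
      ∫ q in T, (2 * (2 * r) * ((2 * r) * A) + 2 * (2 * r) * ((2 * r) * (2 * r)) * G q.1) := by
    refine setIntegral_mono_on (integrableOn_const finT) (i1.add i2) hT (fun q hq => ?_)
    have := st1 q hq
    linarith
  rw [integral_add i1 i2, setIntegral_const, setIntegral_const, integral_const_mul] at st2
  have h2 : ∫ q in T, G q.1 ≤ ∫ q in Metric.closedBall x r, G q.1 :=
    setIntegral_mono_set iG (Eventually.of_forall fun p => G0 _) (LE.le.eventuallyLE hTQ)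
  rw [intG] at h2
  simp only [smul_eq_mul] at st2
  rw [intg]
  have h3 : volume.real T * (2 * (2 * r) * (2 * r * A))
      ≤ (2 * r) * (2 * r) * (2 * (2 * r) * (2 * r * A)) :=
    mul_le_mul_of_nonneg_right leT (by positivity)
  have h4 : 2 * (2 * r) * ((2 * r) * (2 * r)) * (∫ q in T, G q.1) ≤
      2 * (2 * r) * ((2 * r) * (2 * r)) * (2 * r * B) :=
    mul_le_mul_of_nonneg_left h2 (by positivity)
  linarith

/-- The sequence `h` tends to zero in measure on `S`. -/
def VanishesOn (h : ℕ → ℝ × ℝ → ℝ) (S : Set (ℝ × ℝ)) : Prop :=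
  ∀ κ > 0, Tendsto (fun n => volume.real (S ∩ {p | κ ≤ h n p})) atTop (𝓝 0)

lemma VanishesOn.mono {h : ℕ → ℝ × ℝ → ℝ} {S T : Set (ℝ × ℝ)} (hT : VanishesOn h T)
    (hfin : volume T ≠ ⊤) (hST : S ⊆ T) : VanishesOn h S := fun κ hκ =>
  squeeze_zero (fun _ => measureReal_nonneg)
    (fun _ => measureReal_mono (inter_subset_inter_left _ hST)
      (measure_ne_top_of_subset inter_subset_left hfin)) (hT κ hκ)

lemma VanishesOn.union {h : ℕ → ℝ × ℝ → ℝ} {S T : Set (ℝ × ℝ)} (hS : VanishesOn h S)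
    (hT : VanishesOn h T) : VanishesOn h (S ∪ T) := fun κ hκ => by
  refine squeeze_zero (fun _ => measureReal_nonneg) (fun n => ?_)
    (by simpa using (hS κ hκ).add (hT κ hκ))
  rw [union_inter_distrib_right]
  exact measureReal_union_le _ _

lemma gradSq_log {h : ℝ × ℝ → ℝ} {δ : ℝ} {p : ℝ × ℝ} (hh : DifferentiableAt ℝ h p)
    (hd : h p + δ ≠ 0) :
    gradSq (fun q => Real.log (h q + δ)) p = gradSq h p / (h p + δ) ^ 2 := by
  have h1 : HasFDerivAt (fun q => Real.log (h q + δ)) _ p :=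
    (hh.hasFDerivAt.add_const δ).log hd
  simp only [gradSq, h1.fderiv]
  simp
  field_simp

lemma VanishesOn.propagate {ω : Set (ℝ × ℝ)} {E : ℝ} (hE0 : 0 ≤ E)
    (hE : ∀ g, IsRealTest ω g → E * ∫ p, g p ^ 2 ≤ ∫ p, gradSq g p)
    {h : ℕ → ℝ × ℝ → ℝ} (hh : ∀ n, IsRealTest ω (h n)) (hpos : ∀ n p, 0 ≤ h n p)
    {M : ℝ} (hM : ∀ n, ∫ p, gradSq (h n) p ≤ M)
    (hlim : Tendsto (fun n => (∫ p, gradSq (h n) p) - E * ∫ p, h n p ^ 2) atTop (𝓝 0))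
    {x : ℝ × ℝ} {r r' : ℝ} (hr : 0 < r) (hrr : r < r') (hball : Metric.closedBall x r' ⊆ ω)
    {S : Set (ℝ × ℝ)} (hS : MeasurableSet S) (hSQ : S ⊆ Metric.closedBall x r)
    (hS0 : volume S ≠ 0) (hv : VanishesOn h S) :
    VanishesOn h (Metric.closedBall x r) := by
  let η : ContDiffBump x := ⟨r, r', hr, hrr⟩
  have hη : IsRealTest ω η :=
    ⟨η.contDiff, η.hasCompactSupport, by rw [η.tsupport_eq]; exact hball⟩
  have hη1 : ∀ p, |η p| ≤ 1 := fun p => by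
    rw [abs_of_nonneg η.nonneg]; exact η.le_one
  have finQ : volume (Metric.closedBall x r) ≠ ⊤ := (isCompact_closedBall x r).measure_ne_top
  have finS : volume S ≠ ⊤ := measure_ne_top_of_subset hSQ finQ
  set m := volume.real S with hm
  have hm0 : 0 < m := ENNReal.toReal_pos hS0 finS
  set N := ∫ p, gradSq η p with hN
  have hN0 : 0 ≤ N := integral_nonneg fun p => gradSq_nonneg _ _
  have hM0 : 0 ≤ M := (integral_nonneg fun p => gradSq_nonneg _ _).trans (hM 0)
  set K := 2 * (2 * r) ^ 4 * (4 * N + 2) with hK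
  have hK0 : 0 < K := by positivity
  intro κ hκ
  rw [Metric.tendsto_atTop]
  intro ε hε
  set d := 1 + 4 * K / (m * ε) with hd
  have hd1 : 1 ≤ d := by rw [hd]; have : 0 < 4 * K / (m * ε) := by positivity
                         linarith
  set δ := κ / (2 * Real.exp d) with hδdef
  have hδ : 0 < δ := by positivity
  have hlogd : Real.log κ - Real.log (2 * δ) = d := by
    have : 2 * δ = κ / Real.exp d := by rw [hδdef]; field_simp
    rw [this, Real.log_div hκ.ne' (Real.exp_pos d).ne', Real.log_exp]; ring
  set W := 8 / δ ^ 2 * N + 2 / δ ^ 4 * M with hW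
  have hW0 : 0 ≤ W := by positivity
  set t := 1 / (W + 1) with ht
  have ht0 : 0 < t := by positivity
  have htW : t * W ≤ 1 := by
    rw [ht, div_mul_eq_mul_div, one_mul, div_le_one (by positivity)]; linarith
  have ev1 := hlim.eventually (ge_mem_nhds ht0)
  have ev2 := (hv δ hδ).eventually (ge_mem_nhds (half_pos hm0))
  obtain ⟨n₀, hn₀⟩ := eventually_atTop.1 (ev1.and ev2)
  refine ⟨n₀, fun n hn => ?_⟩
  obtain ⟨hT, hsm⟩ := hn₀ n hn
  have hd0 : ∀ p, 0 < h n p + δ := fun p => by linarith [hpos n p]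
  rw [Real.dist_eq, sub_zero, abs_of_nonneg measureReal_nonneg]
  have hlog : ContDiff ℝ (⊤ : ℕ∞) fun q => Real.log (h n q + δ) :=
    ((hh n).1.add contDiff_const).log fun p => (hd0 p).ne'
  have hmeas : Measurable (h n) := (hh n).continuous.measurable
  have mge : ∀ c, MeasurableSet {p | c ≤ h n p} := fun c => measurableSet_le measurable_const hmeas
  have mlt : ∀ c, MeasurableSet {p | h n p < c} := fun c => measurableSet_lt hmeas measurable_const
  have base := measure_mul_measure_le_of_le_abs_sub hlog (x := x) (r := r)
    (S := Metric.closedBall x r ∩ {p | κ ≤ h n p}) (T := S ∩ {p | h n p < δ})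
    (Metric.isClosed_closedBall.measurableSet.inter (mge κ)) (hS.inter (mlt δ))
    inter_subset_left (inter_subset_left.trans hSQ) (zero_le_one.trans hd1) (by
      rintro p ⟨-, hp⟩ q ⟨-, hq⟩
      simp only [mem_ofPred_eq] at hp hq
      refine le_trans ?_ (le_abs_self _)
      rw [← hlogd]
      have e1 : Real.log κ ≤ Real.log (h n p + δ) := Real.log_le_log hκ (by linarith)
      have e2 : Real.log (h n q + δ) ≤ Real.log (2 * δ) :=
        Real.log_le_log (hd0 q) (by linarith)
      linarith)
  have hlow : m / 2 ≤ volume.real (S ∩ {p | h n p < δ}) := by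
    have e : S = (S ∩ {p | h n p < δ}) ∪ (S ∩ {p | δ ≤ h n p}) := by
      ext p
      simp only [mem_union, mem_inter_iff, mem_ofPred_eq]
      have := lt_or_ge (h n p) δ
      tauto
    have := measureReal_union_le (μ := volume) (S ∩ {p | h n p < δ}) (S ∩ {p | δ ≤ h n p})
    rw [← e] at this
    linarith
  have hen : ∫ p in Metric.closedBall x r, gradSq (fun q => Real.log (h n q + δ)) p
      ≤ 4 * N + 2 := by
    have b := log_energy_bound hE0 hE (hh n) (hpos n) hη hη1 hδ ht0
    have hXc : Continuous fun p => η p ^ 2 * gradSq (h n) p / (h n p + δ) ^ 2 :=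
      ((hη.continuous.pow 2).mul (continuous_gradSq (hh n).1)).div
        (((hh n).continuous.add continuous_const).pow 2) (fun p => by have := hd0 p; positivity)
    have hX : Integrable fun p => η p ^ 2 * gradSq (h n) p / (h n p + δ) ^ 2 :=
      hXc.integrable_of_hasCompactSupport
        (hη.2.1.mono (fun p hp h0 => hp (by simp [h0])))
    have c1 : ∫ p in Metric.closedBall x r, gradSq (fun q => Real.log (h n q + δ)) p
        = ∫ p in Metric.closedBall x r, η p ^ 2 * gradSq (h n) p / (h n p + δ) ^ 2 := by
      refine setIntegral_congr_fun Metric.isClosed_closedBall.measurableSet fun p hp => ?_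
      rw [gradSq_log ((hh n).differentiableAt p) (hd0 p).ne', η.one_of_mem_closedBall hp]
      simp
    rw [c1]
    refine (setIntegral_le_integral hX (Eventually.of_forall fun p => ?_)).trans (b.trans ?_)
    · have := gradSq_nonneg (h n) p
      simp only [Pi.zero_apply]; positivity
    have c2 : ((∫ p, gradSq (h n) p) - E * ∫ p, h n p ^ 2) / t ≤ 1 := by
      rw [div_le_one ht0]; exact hT
    have c3 : t * (8 / δ ^ 2 * N + 2 / δ ^ 4 * ∫ p, gradSq (h n) p) ≤ t * W := by
      rw [hW]; gcongr; exact hM n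
    linarith
  set V := volume.real (Metric.closedBall x r ∩ {p | κ ≤ h n p}) with hV
  have hV0 : 0 ≤ V := measureReal_nonneg
  have f1 : d ^ 2 * (V * (m / 2)) ≤ K := by
    refine le_trans ?_ (base.trans ?_)
    · gcongr
    · rw [hK]; gcongr
  have f2 : d ≤ d ^ 2 := by nlinarith
  have f3 : d * (V * (m / 2)) ≤ K := le_trans (by gcongr) f1
  by_contra hcon
  push Not at hcon
  have f4 : d * (ε * (m / 2)) ≤ K := le_trans (by gcongr) f3
  have f5 : d * (ε * (m / 2)) = ε * m / 2 + 2 * K := by rw [hd]; field_simp; ring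
  have : 0 < ε * m := by positivity
  linarith

lemma exists_pos_measure_ball {ω Z : Set (ℝ × ℝ)} (hZω : Z ⊆ ω) (hZ0 : volume Z ≠ 0) :
    ∃ x ∈ ω, ∀ r > 0, volume (Z ∩ Metric.ball x r) ≠ 0 := by
  obtain ⟨x, hx, h⟩ := exists_mem_forall_mem_nhdsWithin_pos_measure hZ0
  refine ⟨x, hZω hx, fun r hr => ?_⟩
  exact (h _ (inter_mem_nhdsWithin Z (Metric.ball_mem_nhds x hr))).ne'

lemma exists_closedBall_two_mul_subset {ω : Set (ℝ × ℝ)} (hω : IsOpen ω) {x : ℝ × ℝ} (hx : x ∈ ω) :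
    ∃ r > 0, Metric.closedBall x (2 * r) ⊆ ω := by
  obtain ⟨r, hr, h⟩ := Metric.nhds_basis_closedBall.mem_iff.1 (hω.mem_nhds hx)
  exact ⟨r / 2, half_pos hr, by rwa [mul_div_cancel₀ _ (two_ne_zero)]⟩

/-- Vanishing in measure on a non-null subset of a connected open set spreads to every
compact subset. -/
lemma VanishesOn.of_isCompact {ω : Set (ℝ × ℝ)} (hω : IsOpen ω) (hconn : IsPreconnected ω)
    {E : ℝ} (hE0 : 0 ≤ E)
    (hE : ∀ g, IsRealTest ω g → E * ∫ p, g p ^ 2 ≤ ∫ p, gradSq g p)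
    {h : ℕ → ℝ × ℝ → ℝ} (hh : ∀ n, IsRealTest ω (h n)) (hpos : ∀ n p, 0 ≤ h n p)
    {M : ℝ} (hM : ∀ n, ∫ p, gradSq (h n) p ≤ M)
    (hlim : Tendsto (fun n => (∫ p, gradSq (h n) p) - E * ∫ p, h n p ^ 2) atTop (𝓝 0))
    {Z : Set (ℝ × ℝ)} (hZ : MeasurableSet Z) (hZω : Z ⊆ ω) (hZfin : volume Z ≠ ⊤)
    (hZ0 : volume Z ≠ 0) (hv : VanishesOn h Z)
    {K : Set (ℝ × ℝ)} (hK : IsCompact K) (hKω : K ⊆ ω) : VanishesOn h K := by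
  set U : Set (ℝ × ℝ) := {x | ∃ r > 0, VanishesOn h (Metric.ball x r)} with hU
  have ballfin : ∀ (x : ℝ × ℝ) r, volume (Metric.ball x r) ≠ ⊤ := fun x r =>
    Metric.isBounded_ball.measure_lt_top.ne
  have hUo : IsOpen U := by
    rw [Metric.isOpen_iff]
    rintro x ⟨r, hr, hx⟩
    refine ⟨r / 2, half_pos hr, fun y hy => ⟨r / 2, half_pos hr, hx.mono (ballfin x r) ?_⟩⟩
    refine Metric.ball_subset_ball' ?_
    rw [Metric.mem_ball] at hy
    linarith
  have hne : (ω ∩ U).Nonempty := by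
    obtain ⟨x, hx, hpos'⟩ := exists_pos_measure_ball hZω hZ0
    obtain ⟨r, hr, hb⟩ := exists_closedBall_two_mul_subset hω hx
    refine ⟨x, hx, r, hr, ?_⟩
    have := VanishesOn.propagate hE0 hE hh hpos hM hlim hr (by linarith : r < 2 * r) hb
      (hZ.inter measurableSet_ball) (inter_subset_right.trans Metric.ball_subset_closedBall)
      (hpos' r hr) (hv.mono hZfin inter_subset_left)
    exact this.mono (isCompact_closedBall x r).measure_ne_top Metric.ball_subset_closedBall
  have hcl : closure U ∩ ω ⊆ U := by
    rintro x ⟨hxc, hx⟩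
    obtain ⟨r, hr, hb⟩ := exists_closedBall_two_mul_subset hω hx
    obtain ⟨y, ⟨s, hs, hy⟩, hxy⟩ := Metric.mem_closure_iff.1 hxc r hr
    have hyb : y ∈ Metric.ball x r := by rwa [Metric.mem_ball, dist_comm]
    have hop : IsOpen (Metric.ball y s ∩ Metric.ball x r) :=
      Metric.isOpen_ball.inter Metric.isOpen_ball
    have := VanishesOn.propagate hE0 hE hh hpos hM hlim hr (by linarith : r < 2 * r) hb
      (S := Metric.ball y s ∩ Metric.ball x r) hop.measurableSet
      (inter_subset_right.trans Metric.ball_subset_closedBall)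
      (hop.measure_ne_zero volume ⟨y, Metric.mem_ball_self hs, hyb⟩)
      (hy.mono (ballfin y s) inter_subset_left)
    exact ⟨r, hr, this.mono (isCompact_closedBall x r).measure_ne_top
      Metric.ball_subset_closedBall⟩
  have hsub : ω ⊆ U := hconn.subset_of_closure_inter_subset hUo hne hcl
  refine hK.induction_on (p := fun S => VanishesOn h S ∧ volume S ≠ ⊤) ?_ ?_ ?_ ?_ |>.1
  · refine ⟨fun κ _ => by simp, by simp⟩
  · exact fun s t hst ht => ⟨ht.1.mono ht.2 hst, measure_ne_top_of_subset hst ht.2⟩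
  · exact fun s t hs ht => ⟨hs.1.union ht.1, measure_union_ne_top hs.2 ht.2⟩
  · intro x hx
    obtain ⟨r, hr, hv⟩ := hsub (hKω hx)
    exact ⟨_, mem_nhdsWithin_of_mem_nhds (Metric.ball_mem_nhds x hr), hv, ballfin x r⟩

lemma norm_clm_prod_le (L : ℝ × ℝ →L[ℝ] ℝ) : ‖L‖ ≤ |L (1, 0)| + |L (0, 1)| := by
  refine L.opNorm_le_bound (by positivity) fun v => ?_
  have e : L v = v.1 * L (1, 0) + v.2 * L (0, 1) := by
    have : v = v.1 • ((1 : ℝ), (0 : ℝ)) + v.2 • ((0 : ℝ), (1 : ℝ)) := by ext <;> simp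
    conv_lhs => rw [this]
    rw [map_add, map_smul, map_smul, smul_eq_mul, smul_eq_mul]
  have h1 : |v.1| ≤ ‖v‖ := norm_fst_le v
  have h2 : |v.2| ≤ ‖v‖ := norm_snd_le v
  rw [e, Real.norm_eq_abs]
  calc |v.1 * L (1, 0) + v.2 * L (0, 1)| ≤ |v.1| * |L (1, 0)| + |v.2| * |L (0, 1)| := by
        rw [← abs_mul, ← abs_mul]; exact abs_add_le _ _
    _ ≤ ‖v‖ * |L (1, 0)| + ‖v‖ * |L (0, 1)| := by gcongr
    _ = _ := by ring

/-- A form of Ladyzhenskaya's inequality. -/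
lemma exists_integral_pow_four_le : ∃ C : ℝ, 0 ≤ C ∧ ∀ (ω : Set (ℝ × ℝ)) (h : ℝ × ℝ → ℝ),
    IsRealTest ω h → ∫ p, h p ^ 4 ≤ C * ((∫ p, h p ^ 2) + 2 * ∫ p, gradSq h p) ^ 2 := by
  set c : NNReal :=
    eLpNormLESNormFDerivOneConst (volume : Measure (ℝ × ℝ)) ((2 : NNReal) : ℝ) with hc
  refine ⟨(c : ℝ) ^ 2, by positivity, fun ω h hh => ?_⟩
  have hsm : ContDiff ℝ 1 fun p => h p ^ 2 := (hh.1.pow 2).of_le (by simp)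
  have hcs : HasCompactSupport fun p => h p ^ 2 :=
    hh.2.1.mono (fun p hp h0 => hp (by simp [h0]))
  have key := eLpNorm_le_eLpNorm_fderiv_one volume hsm hcs (p := 2) (by
    rw [Module.finrank_prod, Module.finrank_self]
    norm_num [NNReal.holderConjugate_iff])
  have hfc : Continuous fun p => fderiv ℝ (fun p => h p ^ 2) p :=
    hsm.continuous_fderiv (by simp)
  have hfi : Integrable fun p => fderiv ℝ (fun p => h p ^ 2) p :=
    hfc.integrable_of_hasCompactSupport (hcs.fderiv (𝕜 := ℝ))
  have h4i : Integrable fun p => (h p ^ 2) ^ 2 :=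
    ((hh.continuous.pow 2).pow 2).integrable_of_hasCompactSupport
      (hh.2.1.mono (fun p hp h0 => hp (by simp [h0])))
  have hmem : MemLp (fun p => h p ^ 2) 2 :=
    (memLp_two_iff_integrable_sq (hh.continuous.pow 2).aestronglyMeasurable).2 h4i
  have hR : eLpNorm (fderiv ℝ fun p => h p ^ 2) 1 volume =
      ENNReal.ofReal (∫ p, ‖fderiv ℝ (fun p => h p ^ 2) p‖) := by
    rw [eLpNorm_one_eq_lintegral_enorm, ofReal_integral_norm_eq_lintegral_enorm hfi]
  have hLL : eLpNorm (fun p => h p ^ 2) 2 volume =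
      ENNReal.ofReal ((∫ p, h p ^ 4) ^ (1 / 2 : ℝ)) := by
    rw [hmem.eLpNorm_eq_integral_rpow_norm (by norm_num) (by norm_num)]
    congr 2
    · refine integral_congr_ae (Eventually.of_forall fun p => ?_)
      simp only [ENNReal.toReal_ofNat, Real.norm_eq_abs]
      rw [Real.rpow_ofNat, sq_abs]; ring
    · simp
  have cast2 : ((2 : NNReal) : ENNReal) = 2 := rfl
  rw [cast2, hLL, hR, ← ENNReal.ofReal_coe_nnreal, ← ENNReal.ofReal_mul (by positivity),
    ENNReal.ofReal_le_ofReal_iff (by positivity)] at key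
  have hb : ∫ p, ‖fderiv ℝ (fun p => h p ^ 2) p‖ ≤ (∫ p, h p ^ 2) + 2 * ∫ p, gradSq h p := by
    rw [← integral_const_mul, ← integral_add hh.integrable_sq (hh.integrable_gradSq.const_mul 2)]
    refine integral_mono hfi.norm (hh.integrable_sq.add (hh.integrable_gradSq.const_mul 2))
      fun p => ?_
    have e : fderiv ℝ (fun p => h p ^ 2) p = (2 * h p) • fderiv ℝ h p := by
      rw [((hh.differentiableAt p).hasFDerivAt.pow 2).fderiv]
      simp
    simp only
    rw [e, norm_smul, Real.norm_eq_abs, abs_mul, abs_two]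
    have n := norm_clm_prod_le (fderiv ℝ h p)
    set a := |fderiv ℝ h p (1, 0)| with ha
    set b := |fderiv ℝ h p (0, 1)| with hb
    have g : gradSq h p = a ^ 2 + b ^ 2 := by rw [ha, hb, sq_abs, sq_abs]; rfl
    rw [g, ← sq_abs (h p)]
    have n2 : 2 * |h p| * ‖fderiv ℝ h p‖ ≤ 2 * |h p| * (a + b) := by gcongr
    nlinarith [sq_nonneg (|h p| - (a + b)), sq_nonneg (a - b)]
  have h40 : 0 ≤ ∫ p, h p ^ 4 := integral_nonneg fun p => by positivity
  rw [← Real.sqrt_eq_rpow] at key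
  have k2 : √(∫ p, h p ^ 4) ≤ c * ((∫ p, h p ^ 2) + 2 * ∫ p, gradSq h p) :=
    key.trans (by gcongr)
  calc ∫ p, h p ^ 4 = √(∫ p, h p ^ 4) ^ 2 := (Real.sq_sqrt h40).symm
    _ ≤ (c * ((∫ p, h p ^ 2) + 2 * ∫ p, gradSq h p)) ^ 2 := by gcongr
    _ = _ := by ring

namespace IsRealTest

variable {ω : Set (ℝ × ℝ)} {h : ℝ × ℝ → ℝ}

lemma const_mul (hh : IsRealTest ω h) (c : ℝ) : IsRealTest ω (fun p => c * h p) := by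
  have := hh.mul_smooth (contDiff_const (c := c))
  simpa only [mul_comm] using this

lemma integrable_pow_four (hh : IsRealTest ω h) : Integrable (fun p => h p ^ 4) :=
  (hh.continuous.pow 4).integrable_of_hasCompactSupport
    (hh.2.1.mono (fun p hp h0 => hp (by simp [h0])))

lemma gradSq_const_mul (hh : IsRealTest ω h) (c : ℝ) (p : ℝ × ℝ) :
    gradSq (fun q => c * h q) p = c ^ 2 * gradSq h p := by
  simp only [gradSq, ((hh.differentiableAt p).hasFDerivAt.const_mul c).fderiv]
  simp
  ring

end IsRealTest

/-- A sequence of normalised test functions with bounded energy cannot tend to zero locally in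
measure. -/
lemma not_vanishesOn_of_integral_sq_eq_one {ω : Set (ℝ × ℝ)} (hω : IsOpen ω)
    (hbdd : Bornology.IsBounded ω) {h : ℕ → ℝ × ℝ → ℝ} (hh : ∀ n, IsRealTest ω (h n))
    (hpos : ∀ n p, 0 ≤ h n p) (hone : ∀ n, ∫ p, h n p ^ 2 = 1) {M : ℝ}
    (hM : ∀ n, ∫ p, gradSq (h n) p ≤ M)
    (hv : ∀ K, IsCompact K → K ⊆ ω → VanishesOn h K) : False := by
  obtain ⟨C, hC0, hC⟩ := exists_integral_pow_four_le
  have hM0 : 0 ≤ M := (integral_nonneg fun p => gradSq_nonneg _ _).trans (hM 0)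
  set D := C * (1 + 2 * M) ^ 2 with hD
  have hD0 : 0 ≤ D := by positivity
  have h4 : ∀ n, ∫ p, h n p ^ 4 ≤ D := fun n => by
    refine (hC ω (h n) (hh n)).trans ?_
    have g0 : 0 ≤ ∫ p, gradSq (h n) p := integral_nonneg fun p => gradSq_nonneg _ _
    have := hM n
    rw [hone n, hD]
    gcongr
  have finω : volume ω ≠ ⊤ := hbdd.measure_lt_top.ne
  set V := volume.real ω with hV
  have hV0 : 0 ≤ V := measureReal_nonneg
  set κ := √(1 / (4 * (V + 1))) with hκ
  have hκ0 : 0 < κ := by rw [hκ]; positivity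
  have hκ2 : κ ^ 2 * V ≤ 1 / 4 := by
    rw [hκ, Real.sq_sqrt (by positivity), div_mul_eq_mul_div, one_mul,
      div_le_div_iff₀ (by positivity) (by norm_num)]
    linarith
  set β := 1 / (2 * (D + 1)) with hβ
  have hβ0 : 0 < β := by positivity
  have hβD : β / 2 * D ≤ 1 / 4 := by
    rw [hβ, div_div, div_mul_eq_mul_div, one_mul, div_le_div_iff₀ (by positivity) (by norm_num)]
    linarith
  obtain ⟨K, hKω, hKc, hKd⟩ := hω.measurableSet.exists_isCompact_sdiff_lt finω
    (ε := ENNReal.ofReal (β / 4)) (by simpa using by positivity)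
  have hKd' : volume.real (ω \ K) ≤ β / 4 := ENNReal.toReal_le_of_le_ofReal (by positivity) hKd.le
  obtain ⟨n, hn⟩ := ((hv K hKc hKω κ hκ0).eventually
    (ge_mem_nhds (show (0 : ℝ) < β / 4 by positivity))).exists
  set A := {p | κ ≤ h n p} with hA
  have hAm : MeasurableSet A := measurableSet_le measurable_const (hh n).continuous.measurable
  have hωA : volume.real (ω ∩ A) ≤ β / 2 := by
    have s : ω ∩ A ⊆ (K ∩ A) ∪ (ω \ K) := by
      rintro p ⟨h1, h2⟩
      by_cases hp : p ∈ K
      · exact Or.inl ⟨hp, h2⟩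
      · exact Or.inr ⟨h1, hp⟩
    have := (measureReal_mono s (measure_union_ne_top
      (measure_ne_top_of_subset (inter_subset_left.trans hKω) finω)
      (measure_ne_top_of_subset sdiff_subset finω))).trans (measureReal_union_le _ _)
    linarith
  have i1 : IntegrableOn (fun _ : ℝ × ℝ => κ ^ 2) ω := integrableOn_const finω
  have i2 : IntegrableOn (A.indicator fun _ : ℝ × ℝ => 1 / (2 * β)) ω :=
    (integrableOn_const finω).indicator hAm
  have i3 : IntegrableOn (fun p => β / 2 * h n p ^ 4) ω :=
    ((hh n).integrable_pow_four.const_mul _).integrableOn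
  have i12 : IntegrableOn (fun p => κ ^ 2 + A.indicator (fun _ => 1 / (2 * β)) p) ω := i1.add i2
  have e1 : ∫ p in ω, h n p ^ 2 = 1 := by
    rw [← hone n]
    refine setIntegral_eq_integral_of_forall_compl_eq_zero fun p hp => ?_
    have : h n p = 0 := image_eq_zero_of_notMem_tsupport fun hc => hp ((hh n).2.2 hc)
    simp [this]
  have e2 : ∫ p in ω, h n p ^ 2 ≤
      ∫ p in ω, (κ ^ 2 + A.indicator (fun _ => 1 / (2 * β)) p + β / 2 * h n p ^ 4) := by
    refine integral_mono (hh n).integrable_sq.integrableOn (i12.add i3) fun p => ?_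
    have hp := hpos n p
    simp only
    by_cases hpA : p ∈ A
    · rw [indicator_of_mem hpA]
      have e : 1 / (2 * β) + β / 2 * h n p ^ 4 - h n p ^ 2
          = β / 2 * (h n p ^ 2 - 1 / β) ^ 2 := by field_simp; ring
      have : 0 ≤ β / 2 * (h n p ^ 2 - 1 / β) ^ 2 := by positivity
      have := sq_nonneg κ
      linarith
    · rw [indicator_of_notMem hpA]
      have : h n p < κ := not_le.1 hpA
      have h1 : h n p ^ 2 ≤ κ ^ 2 := by gcongr
      have : 0 ≤ β / 2 * h n p ^ 4 := by positivity
      linarith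
  rw [integral_add i12 i3, integral_add i1 i2, setIntegral_indicator hAm, setIntegral_const,
    setIntegral_const, integral_const_mul, e1] at e2
  have e3 : ∫ p in ω, h n p ^ 4 ≤ D :=
    (setIntegral_le_integral (hh n).integrable_pow_four
      (Eventually.of_forall fun p => by simp only [Pi.zero_apply]; positivity)).trans (h4 n)
  have e4 : β / 2 * ∫ p in ω, h n p ^ 4 ≤ β / 2 * D := by gcongr
  have e5 : volume.real (ω ∩ A) * (1 / (2 * β)) ≤ β / 2 * (1 / (2 * β)) := by gcongr
  have e6 : β / 2 * (1 / (2 * β)) = 1 / 4 := by field_simp; norm_num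
  simp only [smul_eq_mul] at e2
  linarith [mul_comm (κ ^ 2) V]

lemma exists_real_gap {ω : Set (ℝ × ℝ)} (hω : IsOpen ω) (hbdd : Bornology.IsBounded ω)
    (hconn : IsPreconnected ω) {E : ℝ} (hE0 : 0 ≤ E)
    (hE : ∀ g, IsRealTest ω g → E * ∫ p, g p ^ 2 ≤ ∫ p, gradSq g p)
    {Z : Set (ℝ × ℝ)} (hZ : MeasurableSet Z) (hZω : Z ⊆ ω) (hZ0 : volume Z ≠ 0) :
    ∃ C > 0, ∀ h, IsRealTest ω h → (∀ p, 0 ≤ h p) →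
      ∫ p, h p ^ 2 ≤ C * ((∫ p, gradSq h p) - E * (∫ p, h p ^ 2) + ∫ p in Z, h p ^ 2) := by
  by_contra! hcon
  have hch : ∀ n : ℕ, ∃ h, IsRealTest ω h ∧ (∀ p, 0 ≤ h p) ∧ ∫ p, h p ^ 2 = 1 ∧
      (∫ p, gradSq h p) - E * (∫ p, h p ^ 2) + ∫ p in Z, h p ^ 2 ≤ 1 / ((n : ℝ) + 1) := by
    intro n
    obtain ⟨h, hh, hpos, hlt⟩ := hcon ((n : ℝ) + 1) (by positivity)
    set S := ∫ p, h p ^ 2 with hS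
    have hT := hE h hh
    have hZ0 : 0 ≤ ∫ p in Z, h p ^ 2 := integral_nonneg fun p => sq_nonneg _
    have hS0 : 0 < S := by
      refine lt_of_le_of_lt ?_ hlt
      have : 0 ≤ (∫ p, gradSq h p) - E * S + ∫ p in Z, h p ^ 2 := by linarith
      positivity
    set c := (√S)⁻¹ with hc
    have hc2 : c ^ 2 = 1 / S := by rw [hc, inv_pow, Real.sq_sqrt hS0.le, one_div]
    refine ⟨fun p => c * h p, hh.const_mul c, fun p => mul_nonneg (by positivity) (hpos p), ?_, ?_⟩
    · simp only [mul_pow, integral_const_mul, hc2]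
      rw [← hS]; field_simp
    · simp only [mul_pow, integral_const_mul, hh.gradSq_const_mul, hc2]
      rw [← hS]
      have e : 1 / S * (∫ p, gradSq h p) - E * (1 / S * S) + 1 / S * ∫ p in Z, h p ^ 2
          = ((∫ p, gradSq h p) - E * S + ∫ p in Z, h p ^ 2) / S := by field_simp
      rw [e, div_le_div_iff₀ hS0 (by positivity)]
      linarith
  choose h hh hpos hone hsmall using hch
  have hT0 : ∀ n, 0 ≤ (∫ p, gradSq (h n) p) - E * ∫ p, h n p ^ 2 := fun n => by
    linarith [hE _ (hh n)]
  have hZi : ∀ n, 0 ≤ ∫ p in Z, h n p ^ 2 := fun n => integral_nonneg fun p => sq_nonneg _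
  have hdecay : Tendsto (fun n : ℕ => 1 / ((n : ℝ) + 1)) atTop (𝓝 0) :=
    tendsto_one_div_add_atTop_nhds_zero_nat
  have hlim : Tendsto (fun n => (∫ p, gradSq (h n) p) - E * ∫ p, h n p ^ 2) atTop (𝓝 0) :=
    squeeze_zero hT0 (fun n => by linarith [hsmall n, hZi n]) hdecay
  have hM : ∀ n, ∫ p, gradSq (h n) p ≤ E + 1 := fun n => by
    have h1 := hsmall n
    have h2 := hZi n
    have h3 : 1 / ((n : ℝ) + 1) ≤ 1 := by
      rw [div_le_one (by positivity)]; linarith [(Nat.cast_nonneg n : (0 : ℝ) ≤ n)]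
    rw [hone n] at h1
    linarith
  have finω : volume ω ≠ ⊤ := hbdd.measure_lt_top.ne
  have finZ : volume Z ≠ ⊤ := measure_ne_top_of_subset hZω finω
  have hvZ : VanishesOn h Z := by
    intro κ hκ
    refine squeeze_zero (fun _ => measureReal_nonneg)
      (g := fun n : ℕ => 1 / κ ^ 2 * (1 / ((n : ℝ) + 1)))
      (fun n => ?_) (by simpa only [mul_zero] using hdecay.const_mul (1 / κ ^ 2))
    have hAm : MeasurableSet {p | κ ≤ h n p} :=
      measurableSet_le measurable_const (hh n).continuous.measurable
    have k1 : ∫ _ in Z ∩ {p | κ ≤ h n p}, κ ^ 2 ≤ ∫ p in Z ∩ {p | κ ≤ h n p}, h n p ^ 2 := by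
      refine setIntegral_mono_on (integrableOn_const
        (measure_ne_top_of_subset inter_subset_left finZ))
        (hh n).integrable_sq.integrableOn (hZ.inter hAm) fun p hp => ?_
      have : κ ≤ h n p := hp.2
      gcongr
    have k2 : ∫ p in Z ∩ {p | κ ≤ h n p}, h n p ^ 2 ≤ ∫ p in Z, h n p ^ 2 :=
      setIntegral_mono_set (hh n).integrable_sq.integrableOn
        (Eventually.of_forall fun p => sq_nonneg _) (LE.le.eventuallyLE inter_subset_left)
    rw [setIntegral_const, smul_eq_mul] at k1
    have k3 := hsmall n
    have k4 := hT0 n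
    rw [div_mul_eq_mul_div, one_mul, le_div_iff₀ (by positivity)]
    linarith
  exact not_vanishesOn_of_integral_sq_eq_one hω hbdd hh hpos hone hM fun K hK hKω =>
    VanishesOn.of_isCompact hω hconn hE0 hE hh hpos hM hlim hZ hZω finZ hZ0 hvZ hK hKω

lemma pd1'_eq_fderiv {f : ℝ × ℝ → ℂ} {p : ℝ × ℝ} (hf : DifferentiableAt ℝ f p) :
    pd1' f p = fderiv ℝ f p (1, 0) := by
  have h1 : HasDerivAt (fun t : ℝ => (t, p.2)) ((1 : ℝ), (0 : ℝ)) p.1 :=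
    (hasDerivAt_id p.1).prodMk (hasDerivAt_const _ _)
  exact (HasFDerivAt.comp_hasDerivAt (f := fun t : ℝ => (t, p.2)) p.1 hf.hasFDerivAt h1).deriv

lemma pd2'_eq_fderiv {f : ℝ × ℝ → ℂ} {p : ℝ × ℝ} (hf : DifferentiableAt ℝ f p) :
    pd2' f p = fderiv ℝ f p (0, 1) := by
  have h1 : HasDerivAt (fun t : ℝ => (p.1, t)) ((0 : ℝ), (1 : ℝ)) p.2 :=
    (hasDerivAt_const _ _).prodMk (hasDerivAt_id p.2)
  exact (HasFDerivAt.comp_hasDerivAt (f := fun t : ℝ => (p.1, t)) p.2 hf.hasFDerivAt h1).deriv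

namespace IsTest2

variable {ω : Set (ℝ × ℝ)} {f : ℝ × ℝ → ℂ}

lemma differentiableAt (hf : IsTest2 ω f) (p : ℝ × ℝ) : DifferentiableAt ℝ f p :=
  hf.1.differentiable (by simp) p

lemma continuous (hf : IsTest2 ω f) : Continuous f := hf.1.continuous

lemma integrable_sq (hf : IsTest2 ω f) : Integrable fun p => ‖f p‖ ^ 2 :=
  (hf.continuous.norm.pow 2).integrable_of_hasCompactSupport
    (hf.2.1.mono fun p hp h0 => hp (by simp [h0]))

lemma energy_eq (hf : IsTest2 ω f) (p : ℝ × ℝ) : ‖pd1' f p‖ ^ 2 + ‖pd2' f p‖ ^ 2 =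
    ‖fderiv ℝ f p (1, 0)‖ ^ 2 + ‖fderiv ℝ f p (0, 1)‖ ^ 2 := by
  rw [pd1'_eq_fderiv (hf.differentiableAt p), pd2'_eq_fderiv (hf.differentiableAt p)]

lemma integrable_energy (hf : IsTest2 ω f) :
    Integrable fun p => ‖pd1' f p‖ ^ 2 + ‖pd2' f p‖ ^ 2 := by
  simp only [hf.energy_eq]
  have hc := hf.1.continuous_fderiv (by simp)
  refine Continuous.integrable_of_hasCompactSupport
    (((hc.clm_apply continuous_const).norm.pow 2).add
      ((hc.clm_apply continuous_const).norm.pow 2)) ?_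
  refine (hf.2.1.fderiv (𝕜 := ℝ)).mono fun p hp h0 => hp ?_
  simp [h0]

lemma eq_zero_of_notMem (hf : IsTest2 ω f) {p : ℝ × ℝ} (hp : p ∉ ω) : f p = 0 :=
  image_eq_zero_of_notMem_tsupport fun h => hp (hf.2.2 h)

lemma fderiv_eq_zero_of_notMem (hf : IsTest2 ω f) {p : ℝ × ℝ} (hp : p ∉ ω) :
    fderiv ℝ f p = 0 := by
  by_contra hne
  exact hp (hf.2.2 (support_fderiv_subset ℝ hne))

lemma setIntegral_sq (hf : IsTest2 ω f) : ∫ p in ω, ‖f p‖ ^ 2 = ∫ p, ‖f p‖ ^ 2 :=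
  setIntegral_eq_integral_of_forall_compl_eq_zero fun p hp => by simp [hf.eq_zero_of_notMem hp]

lemma setIntegral_energy (hf : IsTest2 ω f) :
    ∫ p in ω, (‖pd1' f p‖ ^ 2 + ‖pd2' f p‖ ^ 2) = ∫ p, (‖pd1' f p‖ ^ 2 + ‖pd2' f p‖ ^ 2) :=
  setIntegral_eq_integral_of_forall_compl_eq_zero fun p hp => by
    simp [hf.energy_eq, hf.fderiv_eq_zero_of_notMem hp]

lemma integral_sq_pos (hf : IsTest2 ω f) (h0 : f ≠ 0) : 0 < ∫ p, ‖f p‖ ^ 2 := by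
  obtain ⟨p, hp⟩ := Function.ne_iff.1 h0
  exact (hf.continuous.norm.pow 2).integral_pos_of_hasCompactSupport_nonneg_nonzero
    (hf.2.1.mono fun p hp h0 => hp (by simp [h0])) (fun p => sq_nonneg _) (x := p)
    (by simpa using hp)

end IsTest2

lemma E1_nonneg (ω : Set (ℝ × ℝ)) : 0 ≤ E1 ω := by
  refine Real.sInf_nonneg ?_
  rintro r ⟨f, -, -, rfl⟩
  exact div_nonneg (integral_nonneg fun p => by positivity) (integral_nonneg fun p => by positivity)

lemma E1_mul_le {ω : Set (ℝ × ℝ)} {f : ℝ × ℝ → ℂ} (hf : IsTest2 ω f) :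
    E1 ω * ∫ p, ‖f p‖ ^ 2 ≤ ∫ p, (‖pd1' f p‖ ^ 2 + ‖pd2' f p‖ ^ 2) := by
  by_cases h0 : f = 0
  · have : ∫ p, ‖f p‖ ^ 2 = 0 := by simp [h0]
    rw [this, mul_zero]
    exact integral_nonneg fun p => by positivity
  · rw [← le_div_iff₀ (hf.integral_sq_pos h0)]
    refine csInf_le ⟨0, ?_⟩ ⟨f, hf, h0, by rw [hf.setIntegral_sq, hf.setIntegral_energy]⟩
    rintro r ⟨f, -, -, rfl⟩
    exact div_nonneg (integral_nonneg fun p => by positivity)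
      (integral_nonneg fun p => by positivity)

lemma IsRealTest.isTest2_ofReal {ω : Set (ℝ × ℝ)} {h : ℝ × ℝ → ℝ} (hh : IsRealTest ω h) :
    IsTest2 ω fun p => (h p : ℂ) := by
  have hs : Function.support (fun p => (h p : ℂ)) = Function.support h := by
    ext p; simp
  refine ⟨Complex.ofRealCLM.contDiff.comp hh.1, ?_, ?_⟩
  · have := hh.2.1
    rwa [HasCompactSupport, tsupport, hs]
  · rw [tsupport, hs]; exact hh.2.2

lemma E1_mul_le_gradSq {ω : Set (ℝ × ℝ)} {h : ℝ × ℝ → ℝ} (hh : IsRealTest ω h) :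
    E1 ω * ∫ p, h p ^ 2 ≤ ∫ p, gradSq h p := by
  have key := E1_mul_le hh.isTest2_ofReal
  have e : ∀ p, fderiv ℝ (fun p => (h p : ℂ)) p = Complex.ofRealCLM.comp (fderiv ℝ h p) :=
    fun p => (Complex.ofRealCLM.hasFDerivAt.comp p (hh.differentiableAt p).hasFDerivAt).fderiv
  simpa [hh.isTest2_ofReal.energy_eq, e, gradSq] using key

/-- The smooth regularisation `√(|f|² + δ²) - δ` of the modulus of `f`. -/
def smoothNorm (δ : ℝ) (f : ℝ × ℝ → ℂ) (p : ℝ × ℝ) : ℝ := √(‖f p‖ ^ 2 + δ ^ 2) - δ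

section smoothNorm

variable {ω : Set (ℝ × ℝ)} {f : ℝ × ℝ → ℂ} {δ : ℝ}

lemma smoothNorm_nonneg (δ : ℝ) (f : ℝ × ℝ → ℂ) (p : ℝ × ℝ) : 0 ≤ smoothNorm δ f p := by
  have : δ ≤ √(‖f p‖ ^ 2 + δ ^ 2) := Real.le_sqrt_of_sq_le (by nlinarith [sq_nonneg ‖f p‖])
  unfold smoothNorm; linarith

lemma smoothNorm_le (hδ : 0 < δ) (f : ℝ × ℝ → ℂ) (p : ℝ × ℝ) : smoothNorm δ f p ≤ ‖f p‖ := by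
  have : √(‖f p‖ ^ 2 + δ ^ 2) ≤ ‖f p‖ + δ :=
    Real.sqrt_le_iff.2 ⟨by positivity, by nlinarith [norm_nonneg (f p)]⟩
  unfold smoothNorm; linarith

lemma norm_sq_le_smoothNorm_sq (hδ : 0 < δ) (f : ℝ × ℝ → ℂ) (p : ℝ × ℝ) :
    ‖f p‖ ^ 2 ≤ smoothNorm δ f p ^ 2 + 2 * δ * ‖f p‖ := by
  have h1 := smoothNorm_le hδ f p
  have h2 : (smoothNorm δ f p + δ) ^ 2 = ‖f p‖ ^ 2 + δ ^ 2 := by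
    rw [smoothNorm, sub_add_cancel, Real.sq_sqrt (by positivity)]
  nlinarith

lemma isRealTest_smoothNorm (hf : IsTest2 ω f) (hδ : 0 < δ) :
    IsRealTest ω (smoothNorm δ f) := by
  have hs : Function.support (smoothNorm δ f) ⊆ Function.support f := by
    intro p hp h0
    apply hp
    simp [smoothNorm, h0, Real.sqrt_sq hδ.le]
  refine ⟨?_, hf.2.1.mono hs, (closure_mono hs).trans hf.2.2⟩
  have : ContDiff ℝ (⊤ : ℕ∞) fun p => ‖f p‖ ^ 2 + δ ^ 2 :=
    (hf.1.norm_sq ℝ).add contDiff_const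
  exact (this.sqrt fun p => by positivity).sub contDiff_const

lemma fderiv_smoothNorm_sq_le (hf : IsTest2 ω f) (hδ : 0 < δ) (p v : ℝ × ℝ) :
    (fderiv ℝ (smoothNorm δ f) p v) ^ 2 ≤ ‖fderiv ℝ f p v‖ ^ 2 := by
  have hd := ((hf.differentiableAt p).hasFDerivAt.norm_sq.add_const (δ ^ 2)).sqrt
    (by positivity)
  have hd' := hd.sub_const δ
  have e : fderiv ℝ (smoothNorm δ f) p = _ := hd'.fderiv
  rw [e]
  have hS : 0 < √(‖f p‖ ^ 2 + δ ^ 2) := by positivity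
  have hS2 : √(‖f p‖ ^ 2 + δ ^ 2) ^ 2 = ‖f p‖ ^ 2 + δ ^ 2 := Real.sq_sqrt (by positivity)
  have hin := abs_real_inner_le_norm (f p) (fderiv ℝ f p v)
  have hin2 : (inner ℝ (f p) (fderiv ℝ f p v)) ^ 2 ≤ ‖f p‖ ^ 2 * ‖fderiv ℝ f p v‖ ^ 2 := by
    rw [← sq_abs, ← mul_pow]; gcongr
  have e2 : (((1 / (2 * √(‖f p‖ ^ 2 + δ ^ 2))) •
      (2 • (innerSL ℝ (f p)).comp (fderiv ℝ f p))) v : ℝ)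
      = inner ℝ (f p) (fderiv ℝ f p v) / √(‖f p‖ ^ 2 + δ ^ 2) := by
    simp
    field_simp
  rw [e2, div_pow, hS2, div_le_iff₀ (by positivity)]
  nlinarith [sq_nonneg ‖fderiv ℝ f p v‖, sq_nonneg δ,
    mul_nonneg (sq_nonneg ‖fderiv ℝ f p v‖) (sq_nonneg δ)]

lemma gradSq_smoothNorm_le (hf : IsTest2 ω f) (hδ : 0 < δ) (p : ℝ × ℝ) :
    gradSq (smoothNorm δ f) p ≤ ‖pd1' f p‖ ^ 2 + ‖pd2' f p‖ ^ 2 := by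
  rw [hf.energy_eq]
  exact add_le_add (fderiv_smoothNorm_sq_le hf hδ p _) (fderiv_smoothNorm_sq_le hf hδ p _)

end smoothNorm

/-- On a connected bounded open set, the distance of a test function to the ground state is
controlled by its energy excess as soon as it is small on a set of positive measure. -/
lemma exists_complex_gap {ω : Set (ℝ × ℝ)} (hω : IsOpen ω) (hbdd : Bornology.IsBounded ω)
    (hconn : IsPreconnected ω) {Z : Set (ℝ × ℝ)} (hZ : MeasurableSet Z) (hZω : Z ⊆ ω)
    (hZ0 : volume Z ≠ 0) :
    ∃ C > 0, ∀ f, IsTest2 ω f → ∫ p, ‖f p‖ ^ 2 ≤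
      C * ((∫ p, (‖pd1' f p‖ ^ 2 + ‖pd2' f p‖ ^ 2)) - E1 ω * (∫ p, ‖f p‖ ^ 2)
        + ∫ p in Z, ‖f p‖ ^ 2) := by
  obtain ⟨C, hC, hgap⟩ := exists_real_gap hω hbdd hconn (E1_nonneg ω)
    (fun g hg => E1_mul_le_gradSq hg) hZ hZω hZ0
  refine ⟨C, hC, fun f hf => ?_⟩
  set N := ∫ p, ‖f p‖ ^ 2 with hN
  set T := ∫ p, (‖pd1' f p‖ ^ 2 + ‖pd2' f p‖ ^ 2) with hT
  set W := ∫ p in Z, ‖f p‖ ^ 2 with hW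
  set L := ∫ p, ‖f p‖ with hL
  have hLi : Integrable fun p => ‖f p‖ :=
    hf.continuous.norm.integrable_of_hasCompactSupport hf.2.1.norm
  have key : ∀ δ : ℝ, 0 < δ → N ≤ C * (T - E1 ω * (N - 2 * δ * L) + W) + 2 * δ * L := by
    intro δ hδ
    have ht := isRealTest_smoothNorm hf hδ
    have h1 := hgap _ ht (smoothNorm_nonneg δ f)
    have h2 : ∫ p, gradSq (smoothNorm δ f) p ≤ T :=
      integral_mono ht.integrable_gradSq hf.integrable_energy (gradSq_smoothNorm_le hf hδ)
    have h3 : N ≤ (∫ p, smoothNorm δ f p ^ 2) + 2 * δ * L := by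
      rw [hL, ← integral_const_mul, ← integral_add ht.integrable_sq (hLi.const_mul _)]
      exact integral_mono hf.integrable_sq (ht.integrable_sq.add (hLi.const_mul _))
        (norm_sq_le_smoothNorm_sq hδ f)
    have h4 : ∫ p in Z, smoothNorm δ f p ^ 2 ≤ W :=
      integral_mono ht.integrable_sq.integrableOn hf.integrable_sq.integrableOn fun p => by
        have := smoothNorm_nonneg δ f p
        have := smoothNorm_le hδ f p
        simp only
        gcongr
    have h5 := E1_nonneg ω
    have h6 : E1 ω * (N - 2 * δ * L) ≤ E1 ω * ∫ p, smoothNorm δ f p ^ 2 := by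
      gcongr; linarith
    have h7 : C * ((∫ p, gradSq (smoothNorm δ f) p) - E1 ω * (∫ p, smoothNorm δ f p ^ 2)
        + ∫ p in Z, smoothNorm δ f p ^ 2) ≤ C * (T - E1 ω * (N - 2 * δ * L) + W) := by
      gcongr
    linarith
  have hlim : Tendsto (fun δ : ℝ => C * (T - E1 ω * (N - 2 * δ * L) + W) + 2 * δ * L) (𝓝[>] 0)
      (𝓝 (C * (T - E1 ω * (N - 2 * 0 * L) + W) + 2 * 0 * L)) :=
    (Continuous.tendsto (by fun_prop) 0).mono_left nhdsWithin_le_nhds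
  have := ge_of_tendsto hlim (eventually_mem_nhdsWithin.mono fun δ hδ => key δ hδ)
  simpa using this

lemma rot_rot (a b : ℝ) (p : ℝ × ℝ) : rot a (rot b p) = rot (a + b) p := by
  ext
  · simp only [rot, Real.cos_add, Real.sin_add]; ring
  · simp only [rot, Real.cos_add, Real.sin_add]; ring

lemma rot_zero (p : ℝ × ℝ) : rot 0 p = p := by simp [rot]

lemma rot_neg_rot (a : ℝ) (p : ℝ × ℝ) : rot (-a) (rot a p) = p := by
  rw [rot_rot, neg_add_cancel, rot_zero]

lemma rot_rot_neg (a : ℝ) (p : ℝ × ℝ) : rot a (rot (-a) p) = p := by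
  rw [rot_rot, add_neg_cancel, rot_zero]

lemma continuous_rot_uncurry : Continuous fun x : ℝ × ℝ × ℝ => rot x.1 x.2 := by
  unfold rot; fun_prop

lemma continuous_rot (a : ℝ) : Continuous (rot a) :=
  continuous_rot_uncurry.comp (Continuous.prodMk_right a)

/-- Rotation as a linear map of the plane. -/
def rotLin (a : ℝ) : ℝ × ℝ →ₗ[ℝ] ℝ × ℝ :=
  Matrix.toLin (Module.Basis.finTwoProd ℝ) (Module.Basis.finTwoProd ℝ)
    !![Real.cos a, Real.sin a; -Real.sin a, Real.cos a]

lemma rotLin_apply (a : ℝ) (p : ℝ × ℝ) : rotLin a p = rot a p := by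
  ext
  · simp [rotLin, rot, Matrix.toLin_finTwoProd_apply]; ring
  · simp [rotLin, rot, Matrix.toLin_finTwoProd_apply]; ring

lemma det_rotLin (a : ℝ) : LinearMap.det (rotLin a) = 1 := by
  rw [rotLin, LinearMap.det_toLin, Matrix.det_fin_two_of]
  nlinarith [Real.sin_sq_add_cos_sq a]

lemma measurePreserving_rot (a : ℝ) : MeasurePreserving (rot a) := by
  refine ⟨(continuous_rot a).measurable, ?_⟩
  have : rot a = rotLin a := funext fun p => (rotLin_apply a p).symm
  rw [this, Measure.map_linearMap_addHaar_eq_smul_addHaar _ (by simp [det_rotLin]), det_rotLin]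
  simp

lemma rot_image_eq_preimage (a : ℝ) (ω : Set (ℝ × ℝ)) : rot a '' ω = rot (-a) ⁻¹' ω :=
  congrFun (image_eq_preimage_of_inverse (rot_neg_rot a) (rot_rot_neg a)) ω

lemma integral_comp_rot {F : Type*} [NormedAddCommGroup F] [NormedSpace ℝ F] (a : ℝ)
    (f : ℝ × ℝ → F) : ∫ p, f (rot a p) = ∫ p, f p := by
  refine (measurePreserving_rot a).integral_comp ?_ f
  exact (Homeomorph.mk ⟨rot a, rot (-a), rot_neg_rot a, rot_rot_neg a⟩ (continuous_rot a)
    (continuous_rot (-a))).measurableEmbedding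

/-- If a set is not invariant under a rotation, it is not sent almost everywhere into itself by
any fraction of that rotation. -/
lemma volume_rot_notMem_ne_zero {ω : Set (ℝ × ℝ)} (hω : IsOpen ω)
    (hbdd : Bornology.IsBounded ω) {ϑ : ℝ} (h : volume (symmDiff (rot ϑ '' ω) ω) ≠ 0)
    {n : ℕ} (hn : n ≠ 0) : volume {q ∈ ω | rot (ϑ / n) q ∉ ω} ≠ 0 := by
  intro h0
  apply h
  have step : ω ≤ᵐ[volume] rot (ϑ / n) ⁻¹' ω := by
    rw [ae_le_set]; exact h0
  have iter : ∀ k : ℕ, ω ≤ᵐ[volume] rot (k * (ϑ / n)) ⁻¹' ω := by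
    intro k
    induction k with
    | zero =>
      have : rot ((0 : ℕ) * (ϑ / n)) ⁻¹' ω = ω := by
        ext p; simp [rot_zero]
      rw [this]
      exact EventuallyLE.rfl
    | succ k ih =>
      have e : rot ((k + 1 : ℕ) * (ϑ / n)) ⁻¹' ω
          = rot (ϑ / n) ⁻¹' (rot (k * (ϑ / n)) ⁻¹' ω) := by
        ext p
        simp only [mem_preimage, rot_rot]
        push_cast
        rw [add_mul, one_mul]
      rw [e]
      exact step.trans ((measurePreserving_rot _).quasiMeasurePreserving.preimage_mono_ae ih)
  have full := iter n
  rw [mul_div_cancel₀ _ (Nat.cast_ne_zero.2 hn)] at full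
  have hpre := (measurePreserving_rot ϑ).measure_preimage hω.measurableSet.nullMeasurableSet
  have hae : ω =ᵐ[volume] rot ϑ ⁻¹' ω :=
    ae_eq_of_ae_subset_of_measure_ge full hpre.le hω.measurableSet.nullMeasurableSet
      (by rw [hpre]; exact hbdd.measure_lt_top.ne)
  have hae2 := (measurePreserving_rot (-ϑ)).quasiMeasurePreserving.preimage_ae_eq hae
  have e : rot (-ϑ) ⁻¹' (rot ϑ ⁻¹' ω) = ω := by
    ext p; simp only [mem_preimage, rot_rot_neg]
  rw [e] at hae2
  rw [rot_image_eq_preimage, measure_symmDiff_eq_zero_iff]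
  exact hae2

lemma Twisted.exists_angle {θ : ℝ → ℝ} {ω : Set (ℝ × ℝ)} (htw : Twisted θ ω)
    (hθ : Continuous θ) (hω : IsOpen ω) (hbdd : Bornology.IsBounded ω) :
    ∃ α B x₀ r : ℝ, 0 < B ∧ 0 < r ∧ Icc (x₀ - r) (x₀ + r) ⊆ Icc (-B) B ∧
      (∀ x ∈ Icc (x₀ - r) (x₀ + r), ∃ t ∈ Icc (-B) B, θ x - θ t = α) ∧
      volume {q ∈ ω | rot α q ∉ ω} ≠ 0 := by
  obtain ⟨⟨s, t, hst⟩, ϑ, ⟨hϑ0, -⟩, hϑ⟩ := htw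
  wlog hlt : θ s < θ t generalizing s t
  · exact this t s hst.symm (lt_of_le_of_ne (not_lt.1 hlt) hst.symm)
  obtain ⟨n, hn⟩ := exists_nat_gt (ϑ / (θ t - θ s))
  have hd : 0 < θ t - θ s := sub_pos.2 hlt
  have hn0 : (0 : ℝ) < n := (div_pos hϑ0 hd).trans hn
  have hα : ϑ / n < θ t - θ s := by
    rw [div_lt_iff₀ hd] at hn
    rw [div_lt_iff₀ hn0]; linarith
  have hα0 : 0 < ϑ / n := by positivity
  have hev : ∀ᶠ x in 𝓝 t, θ s + ϑ / n < θ x :=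
    hθ.continuousAt.eventually (lt_mem_nhds (by linarith))
  obtain ⟨r, hr, hball⟩ := Metric.nhds_basis_closedBall.eventually_iff.1 hev
  rw [Real.closedBall_eq_Icc] at hball
  refine ⟨ϑ / n, |s| + |t| + r, t, r, by positivity, hr, ?_, ?_,
    volume_rot_notMem_ne_zero hω hbdd hϑ (by rintro rfl; simp at hn0)⟩
  · intro x hx
    have := abs_nonneg s
    exact ⟨by linarith [hx.1, neg_abs_le t], by linarith [hx.2, le_abs_self t]⟩
  · intro x hx
    have h1 := hball hx
    obtain ⟨y, hy, hyx⟩ := intermediate_value_uIcc (a := s) (b := x) hθ.continuousOn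
      (Icc_subset_uIcc ⟨by linarith, by linarith⟩ : θ x - ϑ / n ∈ uIcc (θ s) (θ x))
    refine ⟨y, ?_, by linarith⟩
    have a1 := neg_abs_le t
    have a2 := le_abs_self t
    have a3 := neg_abs_le s
    have a4 := le_abs_self s
    have a5 := abs_nonneg s
    have a6 := abs_nonneg t
    rw [mem_uIcc] at hy
    rcases hy with hy | hy <;> exact ⟨by linarith [hy.1, hy.2, hx.1, hx.2],
      by linarith [hy.1, hy.2, hx.1, hx.2]⟩

section Fiber

variable {X Y E : Type*} [TopologicalSpace X] [TopologicalSpace Y]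
  [NormedAddCommGroup E] {F : X × Y → E}

lemma HasCompactSupport.fiber_left [R1Space Y] (hF : HasCompactSupport F) (x : X) :
    HasCompactSupport fun y => F (x, y) :=
  HasCompactSupport.intro (hF.image continuous_snd) fun y hy =>
    image_eq_zero_of_notMem_tsupport fun h => hy ⟨(x, y), h, rfl⟩

lemma HasCompactSupport.fiber_right [R1Space X] (hF : HasCompactSupport F) (y : Y) :
    HasCompactSupport fun x => F (x, y) :=
  HasCompactSupport.intro (hF.image continuous_fst) fun x hx =>
    image_eq_zero_of_notMem_tsupport fun h => hx ⟨(x, y), h, rfl⟩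

variable [MeasurableSpace Y] [OpensMeasurableSpace Y] [NormedSpace ℝ E]
  {ν : Measure Y} [IsFiniteMeasureOnCompacts ν]

lemma HasCompactSupport.continuous_fiber_integral (hF : HasCompactSupport F) (hc : Continuous F) :
    Continuous fun x => ∫ y, F (x, y) ∂ν := by
  rw [← continuousOn_univ]
  exact continuousOn_integral_of_compact_support (f := fun x y => F (x, y))
    (hF.image continuous_snd) (hc.comp continuous_id).continuousOn fun x y _ hy =>
      image_eq_zero_of_notMem_tsupport fun h => hy ⟨(x, y), h, rfl⟩

end Fiber

lemma norm_sq_add_smul (z w : ℂ) (h : ℝ) :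
    ‖w + h • z‖ ^ 2 = ‖w‖ ^ 2 + h * (2 * inner ℝ z w) + h ^ 2 * ‖z‖ ^ 2 := by
  rw [norm_add_sq_real, inner_smul_right, norm_smul, mul_pow, Real.norm_eq_abs, sq_abs,
    real_inner_comm]
  ring

/-- Completion of the square against a first-order weight. -/
lemma integral_norm_sq_add_smul {φ φ' : ℝ → ℂ} (hφ : ∀ t, HasDerivAt φ (φ' t) t)
    (hc : Continuous φ') (hs : HasCompactSupport φ) (hs' : HasCompactSupport φ')
    {h h' : ℝ → ℝ} (hh : ∀ t, HasDerivAt h (h' t) t) (hhc : Continuous h') :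
    ∫ t, ‖φ' t + h t • φ t‖ ^ 2 =
      (∫ t, ‖φ' t‖ ^ 2) - ∫ t, (h' t - h t ^ 2) * ‖φ t‖ ^ 2 := by
  have cφ : Continuous φ := continuous_iff_continuousAt.2 fun t => (hφ t).continuousAt
  have ch : Continuous h := continuous_iff_continuousAt.2 fun t => (hh t).continuousAt
  have i1 : Integrable fun t => ‖φ' t‖ ^ 2 :=
    (hc.norm.pow 2).integrable_of_hasCompactSupport (hs'.mono fun p hp h0 => hp (by simp [h0]))
  have i2 : Integrable fun t => (h' t - h t ^ 2) * ‖φ t‖ ^ 2 :=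
    ((hhc.sub (ch.pow 2)).mul (cφ.norm.pow 2)).integrable_of_hasCompactSupport
      (hs.mono fun p hp h0 => hp (by simp [h0]))
  have i3 : Integrable fun t => h' t * ‖φ t‖ ^ 2 + h t * (2 * inner ℝ (φ t) (φ' t)) :=
    ((hhc.mul (cφ.norm.pow 2)).add
      (ch.mul (continuous_const.mul (cφ.inner hc)))).integrable_of_hasCompactSupport
      (hs.mono fun p hp h0 => hp (by simp [h0]))
  have i4 : Integrable fun t => h t * ‖φ t‖ ^ 2 :=
    (ch.mul (cφ.norm.pow 2)).integrable_of_hasCompactSupport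
      (hs.mono fun p hp h0 => hp (by simp [h0]))
  have key := integral_eq_zero_of_hasDerivAt_of_integrable
    (fun t => (hh t).mul (hφ t).norm_sq) i3 i4
  have e : ∀ t, ‖φ' t + h t • φ t‖ ^ 2 = ‖φ' t‖ ^ 2 - (h' t - h t ^ 2) * ‖φ t‖ ^ 2
      + (h' t * ‖φ t‖ ^ 2 + h t * (2 * inner ℝ (φ t) (φ' t))) := fun t => by
    rw [norm_sq_add_smul]; ring
  have i12 : Integrable fun t => ‖φ' t‖ ^ 2 - (h' t - h t ^ 2) * ‖φ t‖ ^ 2 := i1.sub i2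
  simp only [e]
  rw [integral_add i12 i3, integral_sub i1 i2, key, add_zero]

/-- A compactly supported function on `ℝ × ℝ²` together with its continuous first partial
derivative. -/
structure IsProfile (u D : ℝ × ℝ × ℝ → ℂ) : Prop where
  continuous : Continuous u
  continuous_deriv : Continuous D
  hasCompactSupport : HasCompactSupport u
  hasCompactSupport_deriv : HasCompactSupport D
  hasDerivAt : ∀ y p, HasDerivAt (fun t => u (t, p)) (D (y, p)) y

namespace IsProfile

variable {u D : ℝ × ℝ × ℝ → ℂ}

lemma hasCompactSupport_mul_sq (hu : IsProfile u D) (w : ℝ × ℝ × ℝ → ℝ) :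
    HasCompactSupport fun z => w z * ‖u z‖ ^ 2 :=
  hu.hasCompactSupport.mono fun p hp h0 => hp (by simp [h0])

lemma hasCompactSupport_sq (hu : IsProfile u D) : HasCompactSupport fun z => ‖u z‖ ^ 2 :=
  hu.hasCompactSupport.mono fun p hp h0 => hp (by simp [h0])

lemma hasCompactSupport_deriv_sq (hu : IsProfile u D) : HasCompactSupport fun z => ‖D z‖ ^ 2 :=
  hu.hasCompactSupport_deriv.mono fun p hp h0 => hp (by simp [h0])

lemma continuous_add (hu : IsProfile u D) {h : ℝ → ℝ} (hh : Continuous h) :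
    Continuous fun z : ℝ × ℝ × ℝ => ‖D z + h z.1 • u z‖ ^ 2 :=
  (hu.continuous_deriv.add ((hh.comp continuous_fst).smul hu.continuous)).norm.pow 2

lemma hasCompactSupport_add (hu : IsProfile u D) (h : ℝ → ℝ) :
    HasCompactSupport fun z : ℝ × ℝ × ℝ => ‖D z + h z.1 • u z‖ ^ 2 := by
  have h1 : HasCompactSupport fun z : ℝ × ℝ × ℝ => h z.1 • u z :=
    hu.hasCompactSupport.mono fun p hp h0 => hp (by simp [h0])
  have h2 : HasCompactSupport fun z : ℝ × ℝ × ℝ => D z + h z.1 • u z :=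
    hu.hasCompactSupport_deriv.add h1
  exact h2.mono fun p hp h0 => hp (by simp only [h0, norm_zero]; norm_num)

lemma integral_add_smul (hu : IsProfile u D) {h h' : ℝ → ℝ}
    (hh : ∀ t, HasDerivAt h (h' t) t) (hhc : Continuous h') :
    ∫ z : ℝ × ℝ × ℝ, ‖D z + h z.1 • u z‖ ^ 2 =
      (∫ z, ‖D z‖ ^ 2) - ∫ z : ℝ × ℝ × ℝ, (h' z.1 - h z.1 ^ 2) * ‖u z‖ ^ 2 := by
  have ch : Continuous h := continuous_iff_continuousAt.2 fun t => (hh t).continuousAt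
  have i1 := (hu.continuous_add ch).integrable_of_hasCompactSupport
    (μ := (volume : Measure ℝ).prod (volume : Measure (ℝ × ℝ))) (hu.hasCompactSupport_add h)
  have i2 : Integrable (fun z => ‖D z‖ ^ 2)
      ((volume : Measure ℝ).prod (volume : Measure (ℝ × ℝ))) :=
    (hu.continuous_deriv.norm.pow 2).integrable_of_hasCompactSupport hu.hasCompactSupport_deriv_sq
  have cw : Continuous fun z : ℝ × ℝ × ℝ => (h' z.1 - h z.1 ^ 2) * ‖u z‖ ^ 2 :=
    ((hhc.comp continuous_fst).sub ((ch.comp continuous_fst).pow 2)).mul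
      (hu.continuous.norm.pow 2)
  have i3 := cw.integrable_of_hasCompactSupport
    (μ := (volume : Measure ℝ).prod (volume : Measure (ℝ × ℝ))) (hu.hasCompactSupport_mul_sq _)
  rw [Measure.volume_eq_prod, integral_prod_symm _ i1, integral_prod_symm _ i2,
    integral_prod_symm _ i3, ← integral_sub i2.integral_prod_right i3.integral_prod_right]
  refine integral_congr_ae (Eventually.of_forall fun p => ?_)
  exact integral_norm_sq_add_smul (fun t => hu.hasDerivAt t p)
    (hu.continuous_deriv.comp (Continuous.prodMk_left p))
    (hu.hasCompactSupport.fiber_right p) (hu.hasCompactSupport_deriv.fiber_right p) hh hhc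

/-- Ground state representation of the harmonic oscillator. -/
lemma integral_ground_state (hu : IsProfile u D) :
    (∫ z, ‖D z‖ ^ 2) + 1 / 16 * (∫ z : ℝ × ℝ × ℝ, z.1 ^ 2 * ‖u z‖ ^ 2) =
      (∫ z : ℝ × ℝ × ℝ, ‖D z + (z.1 / 4) • u z‖ ^ 2) + 1 / 4 * ∫ z, ‖u z‖ ^ 2 := by
  have key := hu.integral_add_smul (h := fun t => t / 4) (h' := fun _ => 1 / 4)
    (fun t => (hasDerivAt_id t).div_const 4) continuous_const
  have i1 : Integrable fun z => ‖u z‖ ^ 2 :=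
    (hu.continuous.norm.pow 2).integrable_of_hasCompactSupport hu.hasCompactSupport_sq
  have i2 : Integrable fun z : ℝ × ℝ × ℝ => z.1 ^ 2 * ‖u z‖ ^ 2 :=
    ((continuous_fst.pow 2).mul (hu.continuous.norm.pow 2)).integrable_of_hasCompactSupport
      (hu.hasCompactSupport_mul_sq _)
  have e : ∀ z : ℝ × ℝ × ℝ, (1 / 4 - (z.1 / 4) ^ 2) * ‖u z‖ ^ 2 =
      1 / 4 * ‖u z‖ ^ 2 - 1 / 16 * (z.1 ^ 2 * ‖u z‖ ^ 2) := fun z => by ring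
  simp only [e] at key
  rw [integral_sub (i1.const_mul _) (i2.const_mul _), integral_const_mul,
    integral_const_mul] at key
  rw [key]
  ring

/-- Hardy-type inequality: away from a neighbourhood of the origin the excess of the energy over
that of the harmonic oscillator ground state controls the mass. -/
lemma hardy (hu : IsProfile u D) {L : ℝ} (hL : 0 < L) :
    1 / 5 * (∫ z, ‖u z‖ ^ 2) - (1 / 5 + 2 / L ^ 2) * (∫ z in Icc (-L) L ×ˢ univ, ‖u z‖ ^ 2) ≤
      ∫ z : ℝ × ℝ × ℝ, ‖D z + (z.1 / 4) • u z‖ ^ 2 := by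
  set a := L / 2 with ha
  have ha0 : 0 < a := by positivity
  have hk : ∀ t : ℝ, HasDerivAt (fun t : ℝ => t / (t ^ 2 + a ^ 2))
      ((a ^ 2 - t ^ 2) / (t ^ 2 + a ^ 2) ^ 2) t := fun t => by
    have h1 : HasDerivAt (fun t : ℝ => t ^ 2 + a ^ 2) (2 * t) t := by
      simpa using (hasDerivAt_pow 2 t).add_const (a ^ 2)
    refine ((hasDerivAt_id t).div h1 (by positivity)).congr_deriv ?_
    simp only [id]; ring
  have hh : ∀ t : ℝ, HasDerivAt (fun t : ℝ => t / 4 - 1 / 2 * (t / (t ^ 2 + a ^ 2)))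
      (1 / 4 - 1 / 2 * ((a ^ 2 - t ^ 2) / (t ^ 2 + a ^ 2) ^ 2)) t := fun t =>
    ((hasDerivAt_id t).div_const 4).sub ((hk t).const_mul _)
  have hne : ∀ t : ℝ, t ^ 2 + a ^ 2 ≠ 0 := fun t => by positivity
  have hhc : Continuous fun t : ℝ => 1 / 4 - 1 / 2 * ((a ^ 2 - t ^ 2) / (t ^ 2 + a ^ 2) ^ 2) :=
    continuous_const.sub (continuous_const.mul
      (Continuous.div (by fun_prop) (by fun_prop) fun t => pow_ne_zero 2 (hne t)))
  have k1 := hu.integral_add_smul hh hhc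
  have k2 := hu.integral_add_smul (h := fun t => t / 4) (h' := fun _ => 1 / 4)
    (fun t => (hasDerivAt_id t).div_const 4) continuous_const
  have k0 : 0 ≤ ∫ z : ℝ × ℝ × ℝ,
      ‖D z + (z.1 / 4 - 1 / 2 * (z.1 / (z.1 ^ 2 + a ^ 2))) • u z‖ ^ 2 :=
    integral_nonneg fun z => by positivity
  have ch : Continuous fun t : ℝ => t / 4 - 1 / 2 * (t / (t ^ 2 + a ^ 2)) :=
    continuous_iff_continuousAt.2 fun t => (hh t).continuousAt
  have i1 : Integrable fun z => ‖u z‖ ^ 2 :=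
    (hu.continuous.norm.pow 2).integrable_of_hasCompactSupport hu.hasCompactSupport_sq
  have iw : ∀ w : ℝ → ℝ, Continuous w → Integrable fun z : ℝ × ℝ × ℝ => w z.1 * ‖u z‖ ^ 2 :=
    fun w hw => ((hw.comp continuous_fst).mul
      (hu.continuous.norm.pow 2)).integrable_of_hasCompactSupport (hu.hasCompactSupport_mul_sq _)
  have j1 := iw (fun t => 1 / 4 - 1 / 2 * ((a ^ 2 - t ^ 2) / (t ^ 2 + a ^ 2) ^ 2)
    - (t / 4 - 1 / 2 * (t / (t ^ 2 + a ^ 2))) ^ 2) (hhc.sub (ch.pow 2))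
  have j2 := iw (fun t => 1 / 4 - (t / 4) ^ 2) (by fun_prop)
  have hS : MeasurableSet (Icc (-L) L ×ˢ (univ : Set (ℝ × ℝ))) :=
    measurableSet_Icc.prod MeasurableSet.univ
  have i2 : Integrable ((Icc (-L) L ×ˢ (univ : Set (ℝ × ℝ))).indicator fun z => ‖u z‖ ^ 2) :=
    i1.indicator hS
  have hmain : 1 / 5 * (∫ z, ‖u z‖ ^ 2) -
      (1 / 5 + 2 / L ^ 2) * (∫ z in Icc (-L) L ×ˢ univ, ‖u z‖ ^ 2) ≤
      (∫ z : ℝ × ℝ × ℝ, (1 / 4 - 1 / 2 * ((a ^ 2 - z.1 ^ 2) / (z.1 ^ 2 + a ^ 2) ^ 2)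
        - (z.1 / 4 - 1 / 2 * (z.1 / (z.1 ^ 2 + a ^ 2))) ^ 2) * ‖u z‖ ^ 2) -
      ∫ z : ℝ × ℝ × ℝ, (1 / 4 - (z.1 / 4) ^ 2) * ‖u z‖ ^ 2 := by
    rw [← integral_indicator hS, ← integral_const_mul, ← integral_const_mul,
      ← integral_sub (i1.const_mul _) (i2.const_mul _), ← integral_sub j1 j2]
    refine integral_mono ((i1.const_mul _).sub (i2.const_mul _)) (j1.sub j2) fun z => ?_
    set y := z.1 with hy
    set N := ‖u z‖ ^ 2 with hN
    have hN0 : 0 ≤ N := by positivity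
    set P := y ^ 2 + a ^ 2 with hP
    have hP0 : 0 < P := by positivity
    have e : (1 / 4 - 1 / 2 * ((a ^ 2 - y ^ 2) / P ^ 2) - (y / 4 - 1 / 2 * (y / P)) ^ 2) * N
        - (1 / 4 - (y / 4) ^ 2) * N
        = 1 / 2 * (((y ^ 2 / 2 - a ^ 2) / P ^ 2 + y ^ 2 / (2 * P)) * N) := by
      field_simp; ring
    simp only
    rw [e]
    have h2 : -(1 / a ^ 2) ≤ (y ^ 2 / 2 - a ^ 2) / P ^ 2 := by
      rw [neg_le_iff_add_nonneg, div_add_div _ _ (by positivity) (by positivity)]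
      refine div_nonneg ?_ (by positivity)
      rw [hP]
      nlinarith [sq_nonneg (a ^ 2), sq_nonneg (y ^ 2), mul_nonneg (sq_nonneg a) (sq_nonneg y)]
    have h3 : 0 ≤ y ^ 2 / (2 * P) := by positivity
    by_cases hz : z ∈ Icc (-L) L ×ˢ (univ : Set (ℝ × ℝ))
    · rw [indicator_of_mem hz]
      have : 1 / a ^ 2 = 4 / L ^ 2 := by rw [ha]; field_simp; norm_num
      rw [this] at h2
      have h4 : -(4 / L ^ 2) * N ≤ ((y ^ 2 / 2 - a ^ 2) / P ^ 2 + y ^ 2 / (2 * P)) * N := by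
        gcongr; linarith
      have h5 : 1 / 5 * N - (1 / 5 + 2 / L ^ 2) * N = 1 / 2 * (-(4 / L ^ 2) * N) := by ring
      rw [← hN, h5]
      linarith
    · rw [indicator_of_notMem hz, mul_zero, sub_zero]
      have hyL : 4 * a ^ 2 ≤ y ^ 2 := by
        have h6 : ¬ (y ∈ Icc (-L) L) := fun h => hz ⟨h, trivial⟩
        rw [mem_Icc, ← abs_le, not_le] at h6
        have : L ^ 2 ≤ |y| ^ 2 := by gcongr
        rw [sq_abs] at this
        rw [ha]; linarith
      have h7 : 0 ≤ (y ^ 2 / 2 - a ^ 2) / P ^ 2 :=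
        div_nonneg (by nlinarith [sq_nonneg a]) (by positivity)
      have h8 : 2 / 5 ≤ y ^ 2 / (2 * P) := by
        rw [div_le_div_iff₀ (by norm_num) (by positivity), hP]; linarith
      have h9 : 2 / 5 * N ≤ ((y ^ 2 / 2 - a ^ 2) / P ^ 2 + y ^ 2 / (2 * P)) * N := by
        gcongr; linarith
      linarith
  linarith

end IsProfile

namespace IsProfile

variable {u D : ℝ × ℝ × ℝ → ℂ}

lemma hasDerivAt_exp_smul (hu : IsProfile u D) (p : ℝ × ℝ) (y : ℝ) :
    HasDerivAt (fun t => Real.exp (t ^ 2 / 8) • u (t, p))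
      (Real.exp (y ^ 2 / 8) • (D (y, p) + (y / 4) • u (y, p))) y := by
  have h1 : HasDerivAt (fun t : ℝ => Real.exp (t ^ 2 / 8)) (Real.exp (y ^ 2 / 8) * (y / 4)) y := by
    have := ((hasDerivAt_pow 2 y).div_const 8).exp
    refine this.congr_deriv ?_
    simp only [Nat.cast_ofNat]; ring
  refine (h1.smul (hu.hasDerivAt y p)).congr_deriv ?_
  rw [smul_add, smul_smul]

lemma norm_exp_smul_sub_sq_le (hu : IsProfile u D) {L B : ℝ} (hLB : L ≤ B) {x t : ℝ}
    (hx : x ∈ Icc (-L) L) (ht : t ∈ Icc (-L) L) (p : ℝ × ℝ) :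
    ‖Real.exp (x ^ 2 / 8) • u (x, p) - Real.exp (t ^ 2 / 8) • u (t, p)‖ ^ 2 ≤
      2 * L * Real.exp (B ^ 2 / 4) * ∫ y in Icc (-L) L, ‖D (y, p) + (y / 4) • u (y, p)‖ ^ 2 := by
  have hL : 0 ≤ L := by linarith [hx.1, hx.2]
  have cW : Continuous fun y : ℝ => D (y, p) + (y / 4) • u (y, p) :=
    (hu.continuous_deriv.comp (Continuous.prodMk_left p)).add
      ((continuous_id.div_const 4).smul (hu.continuous.comp (Continuous.prodMk_left p)))
  have cE : Continuous fun y : ℝ => Real.exp (y ^ 2 / 8) := by fun_prop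
  have key := norm_sub_sq_le (fun y => hu.hasDerivAt_exp_smul p y) (cE.smul cW) hx ht
  refine key.trans ?_
  have e1 : L - -L = 2 * L := by ring
  rw [e1, mul_assoc (2 * L), ← integral_const_mul (Real.exp (B ^ 2 / 4))]
  refine mul_le_mul_of_nonneg_left ?_ (mul_nonneg two_pos.le hL)
  refine setIntegral_mono_on ((cE.smul cW).norm.pow 2).continuousOn.integrableOn_Icc
    (continuous_const.mul (cW.norm.pow 2)).continuousOn.integrableOn_Icc measurableSet_Icc
    fun y hy => ?_
  rw [norm_smul, mul_pow, Real.norm_eq_abs, Real.abs_exp, ← Real.exp_nat_mul]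
  gcongr
  have : y ^ 2 ≤ B ^ 2 := sq_le_sq' (by linarith [hy.1]) (by linarith [hy.2])
  push_cast; linarith

lemma norm_sq_le_of_eq_zero (hu : IsProfile u D) {L B : ℝ} (hLB : L ≤ B) {x t : ℝ}
    (hx : x ∈ Icc (-L) L) (ht : t ∈ Icc (-L) L) {p : ℝ × ℝ} (h0 : u (t, p) = 0) :
    ‖u (x, p)‖ ^ 2 ≤
      2 * L * Real.exp (B ^ 2 / 4) * ∫ y in Icc (-L) L, ‖D (y, p) + (y / 4) • u (y, p)‖ ^ 2 := by
  have key := hu.norm_exp_smul_sub_sq_le hLB hx ht p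
  rw [h0, smul_zero, sub_zero, norm_smul, mul_pow, Real.norm_eq_abs, Real.abs_exp] at key
  refine le_trans (le_mul_of_one_le_left (by positivity) ?_) key
  exact one_le_pow₀ (Real.one_le_exp (by positivity))

lemma norm_sq_le (hu : IsProfile u D) {L B : ℝ} (hLB : L ≤ B) {x t : ℝ}
    (hx : x ∈ Icc (-L) L) (ht : t ∈ Icc (-L) L) (p : ℝ × ℝ) :
    ‖u (x, p)‖ ^ 2 ≤ 2 * Real.exp (B ^ 2 / 4) * ‖u (t, p)‖ ^ 2 +
      4 * L * Real.exp (B ^ 2 / 4) * ∫ y in Icc (-L) L, ‖D (y, p) + (y / 4) • u (y, p)‖ ^ 2 := by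
  have key := hu.norm_exp_smul_sub_sq_le hLB hx ht p
  set a := Real.exp (x ^ 2 / 8) • u (x, p) with ha
  set b := Real.exp (t ^ 2 / 8) • u (t, p) with hb
  have h1 : ‖u (x, p)‖ ^ 2 ≤ ‖a‖ ^ 2 := by
    rw [ha, norm_smul, mul_pow, Real.norm_eq_abs, Real.abs_exp]
    exact le_mul_of_one_le_left (by positivity) (one_le_pow₀ (Real.one_le_exp (by positivity)))
  have h2 : ‖b‖ ^ 2 ≤ Real.exp (B ^ 2 / 4) * ‖u (t, p)‖ ^ 2 := by
    rw [hb, norm_smul, mul_pow, Real.norm_eq_abs, Real.abs_exp, ← Real.exp_nat_mul]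
    gcongr
    have : t ^ 2 ≤ B ^ 2 := sq_le_sq' (by linarith [ht.1]) (by linarith [ht.2])
    push_cast; linarith
  have h3 : ‖a‖ ^ 2 ≤ 2 * ‖b‖ ^ 2 + 2 * ‖a - b‖ ^ 2 := by
    have h4 : ‖a‖ ≤ ‖b‖ + ‖a - b‖ := by simpa using norm_add_le b (a - b)
    have h5 : ‖a‖ ^ 2 ≤ (‖b‖ + ‖a - b‖) ^ 2 := by gcongr
    nlinarith [sq_nonneg (‖b‖ - ‖a - b‖)]
  linarith

lemma integrable_add_sq (hu : IsProfile u D) (μ : Measure (ℝ × ℝ × ℝ))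
    [IsFiniteMeasureOnCompacts μ] :
    Integrable (fun z : ℝ × ℝ × ℝ => ‖D z + (z.1 / 4) • u z‖ ^ 2) μ :=
  (hu.continuous_add (h := fun t => t / 4) (by fun_prop)).integrable_of_hasCompactSupport
    (hu.hasCompactSupport_add fun t => t / 4)

lemma integrable_fiber_energy (hu : IsProfile u D) (L : ℝ) :
    Integrable fun p : ℝ × ℝ => ∫ y in Icc (-L) L, ‖D (y, p) + (y / 4) • u (y, p)‖ ^ 2 :=
  (hu.integrable_add_sq ((volume.restrict (Icc (-L) L)).prod volume)).integral_prod_right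

lemma integral_fiber_energy_le (hu : IsProfile u D) (L : ℝ) :
    ∫ p : ℝ × ℝ, ∫ y in Icc (-L) L, ‖D (y, p) + (y / 4) • u (y, p)‖ ^ 2 ≤
      ∫ z : ℝ × ℝ × ℝ, ‖D z + (z.1 / 4) • u z‖ ^ 2 := by
  have hf := hu.integrable_add_sq ((volume : Measure ℝ).prod (volume : Measure (ℝ × ℝ)))
  rw [Measure.volume_eq_prod ℝ (ℝ × ℝ), integral_prod_symm _ hf]
  refine integral_mono (hu.integrable_fiber_energy L) hf.integral_prod_right fun p => ?_
  refine setIntegral_le_integral ?_ (Eventually.of_forall fun y => by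
    simp only [Pi.zero_apply]; positivity)
  exact ((hu.continuous_add (h := fun t => t / 4) (by fun_prop)).comp
    (Continuous.prodMk_left p)).integrable_of_hasCompactSupport
    ((hu.hasCompactSupport_add fun t => t / 4).fiber_right p)

lemma integrable_fiber (hu : IsProfile u D) (y : ℝ) :
    Integrable fun p => ‖u (y, p)‖ ^ 2 :=
  ((hu.continuous.norm.pow 2).comp
    (Continuous.prodMk_right y)).integrable_of_hasCompactSupport
    (hu.hasCompactSupport_sq.fiber_left y)

/-- If the mass of a profile is controlled on the fibres over a small interval, then it is
controlled on the surrounding interval. -/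
lemma setIntegral_le_of_fiber (hu : IsProfile u D) {T : ℝ → ℝ} (hT : Integrable T)
    (hT0 : ∀ y, 0 ≤ T y) {L B c ρ G C 𝓔 : ℝ} (hL : 0 < L) (hLB : L ≤ B) (hρ : 0 < ρ)
    (hG : G = Real.exp (B ^ 2 / 4)) (hC : 0 < C)
    (hsub : Icc (c - ρ) (c + ρ) ⊆ Icc (-L) L)
    (h𝓔 : 𝓔 = ∫ p : ℝ × ℝ, ∫ y in Icc (-L) L, ‖D (y, p) + (y / 4) • u (y, p)‖ ^ 2)
    (hgap : ∀ y ∈ Icc (c - ρ) (c + ρ), ∫ p, ‖u (y, p)‖ ^ 2 ≤ C * (T y + 2 * L * G * 𝓔)) :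
    ∫ y in Icc (-L) L, ∫ p, ‖u (y, p)‖ ^ 2 ≤
      L / ρ * (2 * G) * (C * ((∫ y, T y) + 4 * L * G * ρ * 𝓔)) + 8 * L ^ 2 * G * 𝓔 := by
  set N : ℝ → ℝ := fun y => ∫ p, ‖u (y, p)‖ ^ 2 with hN
  have cN : Continuous N :=
    hu.hasCompactSupport_sq.continuous_fiber_integral (hu.continuous.norm.pow 2)
  have iN : ∀ a b, IntegrableOn N (Icc a b) := fun a b => cN.continuousOn.integrableOn_Icc
  have hvol : ∀ k : ℝ, ∫ _ in Icc (c - ρ) (c + ρ), k = 2 * ρ * k := fun k => by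
    rw [setIntegral_const, Real.volume_real_Icc_of_le (by linarith), smul_eq_mul]; ring
  have hvolL : ∀ k : ℝ, ∫ _ in Icc (-L) L, k = 2 * L * k := fun k => by
    rw [setIntegral_const, Real.volume_real_Icc_of_le (by linarith), smul_eq_mul]; ring
  have ic : ∀ k a b : ℝ, IntegrableOn (fun _ : ℝ => k) (Icc a b) := fun k a b =>
    continuousOn_const.integrableOn_Icc
  have hG0 : 0 < G := hG ▸ Real.exp_pos _
  have h𝓔0 : 0 ≤ 𝓔 := h𝓔 ▸ integral_nonneg fun p => integral_nonneg fun y => by positivity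
  have hJ : ∫ y in Icc (c - ρ) (c + ρ), N y ≤ C * ((∫ y, T y) + 4 * L * G * ρ * 𝓔) := by
    have h1 : ∫ y in Icc (c - ρ) (c + ρ), N y ≤
        ∫ y in Icc (c - ρ) (c + ρ), C * (T y + 2 * L * G * 𝓔) :=
      setIntegral_mono_on (iN _ _) ((hT.integrableOn.add (ic _ _ _)).const_mul C)
        measurableSet_Icc hgap
    rw [integral_const_mul, integral_add hT.integrableOn (ic _ _ _), hvol] at h1
    have h2 : ∫ y in Icc (c - ρ) (c + ρ), T y ≤ ∫ y, T y :=
      setIntegral_le_integral hT (Eventually.of_forall hT0)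
    refine h1.trans (mul_le_mul_of_nonneg_left ?_ hC.le)
    linarith
  have hcmp : ∀ x ∈ Icc (-L) L, ∀ t ∈ Icc (c - ρ) (c + ρ),
      N x ≤ 2 * G * N t + 4 * L * G * 𝓔 := by
    intro x hx t ht
    have i1 := (hu.integrable_fiber t).const_mul (2 * G)
    have i2 := (hu.integrable_fiber_energy L).const_mul (4 * L * G)
    rw [h𝓔, hN]
    simp only
    rw [← integral_const_mul, ← integral_const_mul, ← integral_add i1 i2]
    refine integral_mono (hu.integrable_fiber x) (i1.add i2) fun p => ?_
    rw [hG]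
    exact hu.norm_sq_le hLB hx (hsub ht) p
  have hpt : ∀ x ∈ Icc (-L) L,
      N x ≤ G / ρ * (∫ y in Icc (c - ρ) (c + ρ), N y) + 4 * L * G * 𝓔 := by
    intro x hx
    have h1 : ∫ _ in Icc (c - ρ) (c + ρ), N x ≤
        ∫ t in Icc (c - ρ) (c + ρ), (2 * G * N t + 4 * L * G * 𝓔) :=
      setIntegral_mono_on (ic _ _ _) (((iN _ _).const_mul _).add (ic _ _ _))
        measurableSet_Icc fun t ht => hcmp x hx t ht
    rw [hvol, integral_add ((iN _ _).const_mul _) (ic _ _ _), hvol, integral_const_mul] at h1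
    have h2 : 2 * ρ * N x ≤ 2 * ρ * (G / ρ * (∫ y in Icc (c - ρ) (c + ρ), N y)
        + 4 * L * G * 𝓔) := by
      refine h1.trans_eq ?_
      field_simp
    exact le_of_mul_le_mul_left h2 (by positivity)
  have h3 : ∫ x in Icc (-L) L, N x ≤
      ∫ _ in Icc (-L) L, (G / ρ * (∫ y in Icc (c - ρ) (c + ρ), N y) + 4 * L * G * 𝓔) :=
    setIntegral_mono_on (iN _ _) (ic _ _ _) measurableSet_Icc hpt
  rw [hvolL] at h3
  have h4 : 2 * L * (G / ρ * (∫ y in Icc (c - ρ) (c + ρ), N y) + 4 * L * G * 𝓔) ≤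
      2 * L * (G / ρ * (C * ((∫ y, T y) + 4 * L * G * ρ * 𝓔)) + 4 * L * G * 𝓔) := by
    gcongr
  refine (h3.trans h4).trans_eq ?_
  field_simp; ring

lemma setIntegral_strip (hu : IsProfile u D) (L : ℝ) :
    ∫ z in Icc (-L) L ×ˢ univ, ‖u z‖ ^ 2 = ∫ y in Icc (-L) L, ∫ p, ‖u (y, p)‖ ^ 2 := by
  have hi : Integrable (fun z => ‖u z‖ ^ 2)
      ((volume : Measure ℝ).prod (volume : Measure (ℝ × ℝ))) :=
    (hu.continuous.norm.pow 2).integrable_of_hasCompactSupport hu.hasCompactSupport_sq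
  rw [Measure.volume_eq_prod, setIntegral_prod _ hi.integrableOn]
  simp

/-- The uniform lower bound, for a profile whose mass is controlled on the fibres over an
interval of length of order `1 / R`. -/
lemma lower_bound (hu : IsProfile u D) {T : ℝ → ℝ} (hT : Integrable T)
    (hT0 : ∀ y, 0 ≤ T y) {R B x₀ r G C K 𝓔 : ℝ} (hR : 1 ≤ R) (hB : 0 < B) (hr : 0 < r)
    (hG : G = Real.exp (B ^ 2 / 4)) (hC : 0 < C)
    (hK : K = B / r * (2 * G) * (C * (1 + 4 * B * G * r)) + 8 * B ^ 2 * G)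
    (hsub : Icc (x₀ - r) (x₀ + r) ⊆ Icc (-B) B)
    (h𝓔 : 𝓔 = ∫ p : ℝ × ℝ, ∫ y in Icc (-(B / R)) (B / R), ‖D (y, p) + (y / 4) • u (y, p)‖ ^ 2)
    (hgap : ∀ y, R * y ∈ Icc (x₀ - r) (x₀ + r) →
      ∫ p, ‖u (y, p)‖ ^ 2 ≤ C * (T y + 2 * (B / R) * G * 𝓔)) :
    1 / 5 / (1 + (1 / 5 + 2 / B ^ 2) * K) * (∫ z, ‖u z‖ ^ 2) ≤
      (∫ z : ℝ × ℝ × ℝ, ‖D z + (z.1 / 4) • u z‖ ^ 2) + R ^ 2 * ∫ y, T y := by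
  have hR0 : 0 < R := by linarith
  have hG0 : 0 < G := hG ▸ Real.exp_pos _
  have hK0 : 0 < K := by rw [hK]; positivity
  have hmem : ∀ y, y ∈ Icc (x₀ / R - r / R) (x₀ / R + r / R) ↔
      R * y ∈ Icc (x₀ - r) (x₀ + r) := fun y => by
    rw [mem_Icc, mem_Icc, ← sub_div, ← add_div, div_le_iff₀ hR0, le_div_iff₀ hR0, mul_comm y]
  have hin := hu.setIntegral_le_of_fiber hT hT0 (L := B / R) (c := x₀ / R) (ρ := r / R)
    (by positivity) (div_le_self hB.le hR) (by positivity) hG hC (fun y hy => by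
      have := hsub ((hmem y).1 hy)
      rw [mem_Icc] at this ⊢
      rw [← neg_div, div_le_iff₀ hR0, le_div_iff₀ hR0, mul_comm y]
      exact this) h𝓔 (fun y hy => hgap y ((hmem y).1 hy))
  have hardy := hu.hardy (L := B / R) (by positivity)
  rw [hu.setIntegral_strip] at hardy
  have h𝓔W : 𝓔 ≤ ∫ z : ℝ × ℝ × ℝ, ‖D z + (z.1 / 4) • u z‖ ^ 2 :=
    h𝓔 ▸ hu.integral_fiber_energy_le _
  have h𝓔0 : 0 ≤ 𝓔 := h𝓔 ▸ integral_nonneg fun p => integral_nonneg fun y => by positivity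
  have hTi : 0 ≤ ∫ y, T y := integral_nonneg hT0
  set W := ∫ z : ℝ × ℝ × ℝ, ‖D z + (z.1 / 4) • u z‖ ^ 2
  set τ := ∫ y, T y
  set I := ∫ y in Icc (-(B / R)) (B / R), ∫ p, ‖u (y, p)‖ ^ 2
  have hI0 : 0 ≤ I := integral_nonneg fun y => integral_nonneg fun p => by positivity
  have h1 : R ^ 2 * I ≤ B / r * (2 * G) * (C * (R ^ 2 * τ + 4 * B * G * r * 𝓔))
      + 8 * B ^ 2 * G * 𝓔 := by
    refine (mul_le_mul_of_nonneg_left hin (sq_nonneg R)).trans_eq ?_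
    field_simp
  have hR2 : 0 ≤ R ^ 2 * τ := by positivity
  have h2 : R ^ 2 * I ≤ K * (W + R ^ 2 * τ) := by
    rw [hK]
    refine h1.trans ?_
    have h3 : R ^ 2 * τ + 4 * B * G * r * 𝓔 ≤ (1 + 4 * B * G * r) * (W + R ^ 2 * τ) := by
      have : 4 * B * G * r * 𝓔 ≤ 4 * B * G * r * (W + R ^ 2 * τ) := by gcongr; linarith
      linarith
    have h4 : 8 * B ^ 2 * G * 𝓔 ≤ 8 * B ^ 2 * G * (W + R ^ 2 * τ) := by gcongr; linarith
    have h5 : B / r * (2 * G) * (C * (R ^ 2 * τ + 4 * B * G * r * 𝓔)) ≤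
        B / r * (2 * G) * (C * ((1 + 4 * B * G * r) * (W + R ^ 2 * τ))) := by gcongr
    linarith
  have h6 : (1 / 5 + 2 / (B / R) ^ 2) * I ≤ (1 / 5 + 2 / B ^ 2) * (R ^ 2 * I) := by
    have e : (1 / 5 + 2 / (B / R) ^ 2) * I = 1 / 5 * I + 2 / B ^ 2 * (R ^ 2 * I) := by
      field_simp
    have : I ≤ R ^ 2 * I := le_mul_of_one_le_left hI0 (one_le_pow₀ hR)
    rw [e]; linarith
  have h7 : (1 / 5 + 2 / B ^ 2) * (R ^ 2 * I) ≤ (1 / 5 + 2 / B ^ 2) * (K * (W + R ^ 2 * τ)) := by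
    gcongr
  rw [div_mul_eq_mul_div, div_le_iff₀ (by positivity)]
  linarith

end IsProfile

lemma setIntegral_Omega0_eq {ω : Set (ℝ × ℝ)} {F : ℝ × ℝ × ℝ → ℝ}
    (hF : ∀ z, z ∉ Omega0 ω → F z = 0) : ∫ z in Omega0 ω, F z = ∫ z, F z :=
  setIntegral_eq_integral_of_forall_compl_eq_zero hF

/-- The shear of `ℝ × ℝ²` rotating the fibre over `y` by the angle `a y`. -/
def rotHomeomorph {a : ℝ → ℝ} (ha : Continuous a) : (ℝ × ℝ × ℝ) ≃ₜ (ℝ × ℝ × ℝ) where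
  toFun z := (z.1, rot (a z.1) z.2)
  invFun z := (z.1, rot (-a z.1) z.2)
  left_inv z := by simp only [rot_neg_rot]
  right_inv z := by simp only [rot_rot_neg]
  continuous_toFun := continuous_fst.prodMk
    (continuous_rot_uncurry.comp ((ha.comp continuous_fst).prodMk continuous_snd))
  continuous_invFun := continuous_fst.prodMk
    (continuous_rot_uncurry.comp ((ha.neg.comp continuous_fst).prodMk continuous_snd))

lemma integral_comp_rotHomeomorph {a : ℝ → ℝ} (ha : Continuous a) {F : ℝ × ℝ × ℝ → ℝ}
    (hF : Continuous F) (hs : HasCompactSupport F) :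
    ∫ z, F (rotHomeomorph ha z) = ∫ z, F z := by
  have h1 := hF.integrable_of_hasCompactSupport
    (μ := (volume : Measure ℝ).prod (volume : Measure (ℝ × ℝ))) hs
  have h2 : Integrable (fun z => F (rotHomeomorph ha z))
      ((volume : Measure ℝ).prod (volume : Measure (ℝ × ℝ))) :=
    (hF.comp (rotHomeomorph ha).continuous).integrable_of_hasCompactSupport
      (hs.comp_isClosedEmbedding (rotHomeomorph ha).isClosedEmbedding)
  rw [Measure.volume_eq_prod ℝ (ℝ × ℝ), integral_prod _ h1, integral_prod _ h2]
  exact integral_congr_ae (Eventually.of_forall fun y => integral_comp_rot (a y) fun p => F (y, p))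

namespace IsTest3

variable {ω : Set (ℝ × ℝ)} {v : ℝ × ℝ × ℝ → ℂ}

lemma differentiableAt (hv : IsTest3 (Omega0 ω) v) (z : ℝ × ℝ × ℝ) : DifferentiableAt ℝ v z :=
  hv.1.differentiable (by simp) z

lemma continuous (hv : IsTest3 (Omega0 ω) v) : Continuous v := hv.1.continuous

lemma pd1_eq (hv : IsTest3 (Omega0 ω) v) (z : ℝ × ℝ × ℝ) : pd1 v z = fderiv ℝ v z (1, 0, 0) := by
  have h1 : HasDerivAt (fun t : ℝ => (t, z.2.1, z.2.2)) ((1 : ℝ), (0 : ℝ), (0 : ℝ)) z.1 :=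
    (hasDerivAt_id z.1).prodMk ((hasDerivAt_const _ _).prodMk (hasDerivAt_const _ _))
  exact (HasFDerivAt.comp_hasDerivAt (f := fun t : ℝ => (t, z.2.1, z.2.2)) z.1
    (hv.differentiableAt z).hasFDerivAt h1).deriv

lemma pd2_eq (hv : IsTest3 (Omega0 ω) v) (z : ℝ × ℝ × ℝ) : pd2 v z = fderiv ℝ v z (0, 1, 0) := by
  have h1 : HasDerivAt (fun t : ℝ => (z.1, t, z.2.2)) ((0 : ℝ), (1 : ℝ), (0 : ℝ)) z.2.1 :=
    (hasDerivAt_const _ _).prodMk ((hasDerivAt_id z.2.1).prodMk (hasDerivAt_const _ _))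
  exact (HasFDerivAt.comp_hasDerivAt (f := fun t : ℝ => (z.1, t, z.2.2)) z.2.1
    (hv.differentiableAt z).hasFDerivAt h1).deriv

lemma pd3_eq (hv : IsTest3 (Omega0 ω) v) (z : ℝ × ℝ × ℝ) : pd3 v z = fderiv ℝ v z (0, 0, 1) := by
  have h1 : HasDerivAt (fun t : ℝ => (z.1, z.2.1, t)) ((0 : ℝ), (0 : ℝ), (1 : ℝ)) z.2.2 :=
    (hasDerivAt_const _ _).prodMk ((hasDerivAt_const _ _).prodMk (hasDerivAt_id z.2.2))
  exact (HasFDerivAt.comp_hasDerivAt (f := fun t : ℝ => (z.1, z.2.1, t)) z.2.2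
    (hv.differentiableAt z).hasFDerivAt h1).deriv

lemma continuous_fderiv_apply (hv : IsTest3 (Omega0 ω) v) (w : ℝ × ℝ × ℝ) :
    Continuous fun z => fderiv ℝ v z w :=
  (hv.1.continuous_fderiv (by simp)).clm_apply continuous_const

lemma continuous_pd1 (hv : IsTest3 (Omega0 ω) v) : Continuous (pd1 v) := by
  rw [funext hv.pd1_eq]; exact hv.continuous_fderiv_apply _

lemma continuous_pd2 (hv : IsTest3 (Omega0 ω) v) : Continuous (pd2 v) := by
  rw [funext hv.pd2_eq]; exact hv.continuous_fderiv_apply _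

lemma continuous_pd3 (hv : IsTest3 (Omega0 ω) v) : Continuous (pd3 v) := by
  rw [funext hv.pd3_eq]; exact hv.continuous_fderiv_apply _

lemma eq_zero (hv : IsTest3 (Omega0 ω) v) {z : ℝ × ℝ × ℝ} (hz : z ∉ Omega0 ω) : v z = 0 :=
  image_eq_zero_of_notMem_tsupport fun h => hz (hv.2.2 h)

lemma fderiv_eq_zero (hv : IsTest3 (Omega0 ω) v) {z : ℝ × ℝ × ℝ} (hz : z ∉ Omega0 ω) :
    fderiv ℝ v z = 0 := by
  by_contra hne
  exact hz (hv.2.2 (support_fderiv_subset ℝ hne))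

lemma hasCompactSupport_energy (hv : IsTest3 (Omega0 ω) v) :
    HasCompactSupport fun z => ‖pd2 v z‖ ^ 2 + ‖pd3 v z‖ ^ 2 :=
  (hv.2.1.fderiv (𝕜 := ℝ)).mono fun z hz h0 => hz (by simp [hv.pd2_eq, hv.pd3_eq, h0])

lemma continuous_energy (hv : IsTest3 (Omega0 ω) v) :
    Continuous fun z => ‖pd2 v z‖ ^ 2 + ‖pd3 v z‖ ^ 2 :=
  (hv.continuous_pd2.norm.pow 2).add (hv.continuous_pd3.norm.pow 2)

lemma hasCompactSupport_sq (hv : IsTest3 (Omega0 ω) v) : HasCompactSupport fun z => ‖v z‖ ^ 2 :=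
  hv.2.1.mono fun z hz h0 => hz (by simp [h0])

lemma isTest2_fiber (hv : IsTest3 (Omega0 ω) v) (y : ℝ) : IsTest2 ω fun p => v (y, p) := by
  refine ⟨hv.1.comp (contDiff_const.prodMk contDiff_id), hv.2.1.fiber_left y, ?_⟩
  refine (closure_minimal (t := Prod.mk y ⁻¹' tsupport v) (fun p hp => subset_tsupport v hp)
    ((isClosed_tsupport v).preimage (Continuous.prodMk_right y))).trans fun p hp => hv.2.2 hp

lemma integral_sq_pos (hv : IsTest3 (Omega0 ω) v) (h0 : v ≠ 0) : 0 < ∫ z, ‖v z‖ ^ 2 := by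
  obtain ⟨z, hz⟩ := Function.ne_iff.1 h0
  exact (hv.continuous.norm.pow 2).integral_pos_of_hasCompactSupport_nonneg_nonzero
    hv.hasCompactSupport_sq (fun _ => sq_nonneg _) (x := z) (by simpa using hz)

end IsTest3

lemma exists_isTest3_ne_zero {ω : Set (ℝ × ℝ)} (hω : IsOpen ω) (hne : ω.Nonempty) :
    ∃ v : ℝ × ℝ × ℝ → ℂ, IsTest3 (Omega0 ω) v ∧ v ≠ 0 := by
  obtain ⟨p, hp⟩ := hne
  have hopen : IsOpen (Omega0 ω) := hω.preimage continuous_snd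
  obtain ⟨ε, hε, hball⟩ := Metric.nhds_basis_closedBall.mem_iff.1
    (hopen.mem_nhds (show ((0 : ℝ), p) ∈ Omega0 ω from hp))
  let b : ContDiffBump ((0 : ℝ), p) := ⟨ε / 2, ε, by positivity, by linarith⟩
  have hs : Function.support (fun z => (b z : ℂ)) = Function.support b := by
    ext z; simp
  refine ⟨fun z => (b z : ℂ), ⟨Complex.ofRealCLM.contDiff.comp b.contDiff, ?_, ?_⟩, ?_⟩
  · have := b.hasCompactSupport
    rwa [HasCompactSupport, tsupport, hs]
  · rw [tsupport, hs]
    exact b.tsupport_eq.subset.trans hball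
  · refine Function.ne_iff.2 ⟨((0 : ℝ), p), ?_⟩
    have : b ((0 : ℝ), p) = 1 := b.one_of_mem_closedBall (Metric.mem_closedBall_self (by
      show 0 ≤ ε / 2; positivity))
    simp [this]

section Untwist

variable {ω : Set (ℝ × ℝ)} {v : ℝ × ℝ × ℝ → ℂ} {θ : ℝ → ℝ}

/-- The longitudinal derivative in the twisted frame. -/
def twistedDeriv (θ : ℝ → ℝ) (s : ℝ) (v : ℝ × ℝ × ℝ → ℂ) (z : ℝ × ℝ × ℝ) : ℂ :=
  pd1 v z - sigmafun θ s z.1 • pdtau v z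

lemma continuous_twist_angle (hθ : ContDiff ℝ 1 θ) (s : ℝ) :
    Continuous fun y => -θ (Real.exp (s / 2) * y) :=
  (hθ.continuous.comp (continuous_const.mul continuous_id)).neg

lemma IsTest3.twistedDeriv_eq (hv : IsTest3 (Omega0 ω) v) (s : ℝ) (z : ℝ × ℝ × ℝ) :
    twistedDeriv θ s v z =
      fderiv ℝ v z (1, -sigmafun θ s z.1 * z.2.2, sigmafun θ s z.1 * z.2.1) := by
  have e : ((1 : ℝ), -sigmafun θ s z.1 * z.2.2, sigmafun θ s z.1 * z.2.1) =
      ((1 : ℝ), (0 : ℝ), (0 : ℝ)) - sigmafun θ s z.1 • (z.2.2 • ((0 : ℝ), (1 : ℝ), (0 : ℝ))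
        - z.2.1 • ((0 : ℝ), (0 : ℝ), (1 : ℝ))) := by
    ext <;> simp
  rw [e, map_sub, map_smul, map_sub, map_smul, map_smul, ← hv.pd1_eq, ← hv.pd2_eq, ← hv.pd3_eq]
  rfl

lemma IsTest3.continuous_twistedDeriv (hv : IsTest3 (Omega0 ω) v) (hθ : ContDiff ℝ 1 θ) (s : ℝ) :
    Continuous (twistedDeriv θ s v) := by
  have cσ : Continuous (sigmafun θ s) :=
    continuous_const.mul ((hθ.continuous_deriv le_rfl).comp (continuous_const.mul continuous_id))
  have h1 := hv.continuous_pd1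
  have h2 := hv.continuous_pd2
  have h3 := hv.continuous_pd3
  unfold twistedDeriv pdtau
  exact h1.sub ((cσ.comp continuous_fst).smul
    (((continuous_snd.comp continuous_snd).smul h2).sub
      ((continuous_fst.comp continuous_snd).smul h3)))

lemma IsTest3.hasCompactSupport_twistedDeriv (hv : IsTest3 (Omega0 ω) v) (s : ℝ) :
    HasCompactSupport (twistedDeriv θ s v) :=
  (hv.2.1.fderiv (𝕜 := ℝ)).mono fun z hz h0 => hz (by simp [hv.twistedDeriv_eq, h0])

/-- Undoing the twist turns the twisted derivative into a plain partial derivative. -/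
lemma IsTest3.isProfile (hv : IsTest3 (Omega0 ω) v) (hθ : ContDiff ℝ 1 θ) (s : ℝ) :
    IsProfile (fun z => v (rotHomeomorph (continuous_twist_angle hθ s) z))
      (fun z => twistedDeriv θ s v (rotHomeomorph (continuous_twist_angle hθ s) z)) where
  continuous := hv.continuous.comp (Homeomorph.continuous _)
  continuous_deriv := (hv.continuous_twistedDeriv hθ s).comp (Homeomorph.continuous _)
  hasCompactSupport := hv.2.1.comp_isClosedEmbedding (Homeomorph.isClosedEmbedding _)
  hasCompactSupport_deriv :=
    (hv.hasCompactSupport_twistedDeriv s).comp_isClosedEmbedding (Homeomorph.isClosedEmbedding _)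
  hasDerivAt y p := by
    have hθd : HasDerivAt (fun t => -θ (Real.exp (s / 2) * t)) (-sigmafun θ s y) y := by
      have h1 : HasDerivAt θ (deriv θ (Real.exp (s / 2) * y)) (Real.exp (s / 2) * y) :=
        (hθ.differentiable (by simp) _).hasDerivAt
      have h2 : HasDerivAt (fun t : ℝ => Real.exp (s / 2) * t) (Real.exp (s / 2)) y := by
        simpa using (hasDerivAt_id y).const_mul (Real.exp (s / 2))
      refine (h1.comp y h2).neg.congr_deriv ?_
      rw [sigmafun, mul_comm]
    set a : ℝ → ℝ := fun t => -θ (Real.exp (s / 2) * t) with ha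
    have hrot : HasDerivAt (fun t => rot (a t) p)
        (-sigmafun θ s y * (rot (a y) p).2, sigmafun θ s y * (rot (a y) p).1) y := by
      have h1 := ((hθd.cos.const_mul p.1).add (hθd.sin.const_mul p.2))
      have h2 := ((hθd.sin.const_mul (-p.1)).add (hθd.cos.const_mul p.2))
      refine (h1.prodMk h2).congr_deriv ?_
      ext
      · simp only [rot]; ring
      · simp only [rot]; ring
    rw [hv.twistedDeriv_eq]
    exact HasFDerivAt.comp_hasDerivAt (f := fun t => (t, rot (a t) p)) y
      (hv.differentiableAt _).hasFDerivAt ((hasDerivAt_id y).prodMk hrot)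

/-- The energy excess of the fibre of `v` over `y`. -/
def fiberExcess (ω : Set (ℝ × ℝ)) (v : ℝ × ℝ × ℝ → ℂ) (y : ℝ) : ℝ :=
  (∫ p, (‖pd2 v (y, p)‖ ^ 2 + ‖pd3 v (y, p)‖ ^ 2)) - E1 ω * ∫ p, ‖v (y, p)‖ ^ 2

lemma IsTest3.fiberExcess_nonneg (hv : IsTest3 (Omega0 ω) v) (y : ℝ) : 0 ≤ fiberExcess ω v y :=
  sub_nonneg.2 (E1_mul_le (hv.isTest2_fiber y))

lemma IsTest3.integrable_sq_prod (hv : IsTest3 (Omega0 ω) v) :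
    Integrable (fun z => ‖v z‖ ^ 2) ((volume : Measure ℝ).prod (volume : Measure (ℝ × ℝ))) :=
  (hv.continuous.norm.pow 2).integrable_of_hasCompactSupport hv.hasCompactSupport_sq

lemma IsTest3.integrable_energy_prod (hv : IsTest3 (Omega0 ω) v) :
    Integrable (fun z => ‖pd2 v z‖ ^ 2 + ‖pd3 v z‖ ^ 2)
      ((volume : Measure ℝ).prod (volume : Measure (ℝ × ℝ))) :=
  hv.continuous_energy.integrable_of_hasCompactSupport hv.hasCompactSupport_energy

lemma IsTest3.integrable_fiberExcess (hv : IsTest3 (Omega0 ω) v) :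
    Integrable (fiberExcess ω v) :=
  hv.integrable_energy_prod.integral_prod_left.sub
    (hv.integrable_sq_prod.integral_prod_left.const_mul _)

lemma IsTest3.integral_fiberExcess (hv : IsTest3 (Omega0 ω) v) :
    ∫ y, fiberExcess ω v y =
      (∫ z, (‖pd2 v z‖ ^ 2 + ‖pd3 v z‖ ^ 2)) - E1 ω * ∫ z, ‖v z‖ ^ 2 := by
  rw [Measure.volume_eq_prod ℝ (ℝ × ℝ), integral_prod _ hv.integrable_energy_prod,
    integral_prod _ hv.integrable_sq_prod, ← integral_const_mul,
    ← integral_sub hv.integrable_energy_prod.integral_prod_left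
      (hv.integrable_sq_prod.integral_prod_left.const_mul _)]
  rfl

lemma IsTest3.Jform_eq (hv : IsTest3 (Omega0 ω) v) (θ : ℝ → ℝ) (s : ℝ) :
    Jform θ ω s v = (∫ z, ‖twistedDeriv θ s v z‖ ^ 2) + 1 / 16 * (∫ z, z.1 ^ 2 * ‖v z‖ ^ 2)
      + Real.exp s * ∫ y, fiberExcess ω v y := by
  have h1 : ∫ z in Omega0 ω, ‖pd1 v z - sigmafun θ s z.1 • pdtau v z‖ ^ 2 =
      ∫ z, ‖twistedDeriv θ s v z‖ ^ 2 :=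
    setIntegral_Omega0_eq fun z hz => by
      have := hv.twistedDeriv_eq (θ := θ) s z
      rw [twistedDeriv, hv.fderiv_eq_zero hz, zero_apply] at this
      rw [this, norm_zero]
      exact zero_pow two_ne_zero
  rw [hv.integral_fiberExcess, Jform, h1,
    setIntegral_Omega0_eq (F := fun z => z.1 ^ 2 * ‖v z‖ ^ 2) fun z hz => by simp [hv.eq_zero hz],
    setIntegral_Omega0_eq (F := fun z => ‖v z‖ ^ 2) fun z hz => by simp [hv.eq_zero hz],
    setIntegral_Omega0_eq (F := fun z => ‖pd2 v z‖ ^ 2 + ‖pd3 v z‖ ^ 2) fun z hz => by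
      simp [hv.pd2_eq, hv.pd3_eq, hv.fderiv_eq_zero hz]]

/-- In a twisted tube the energy excess over the harmonic oscillator ground state controls the
mass, uniformly in the self-similar time. -/
lemma exists_Jform_ge (hω : IsOpen ω) (hbdd : Bornology.IsBounded ω) (hconn : IsPreconnected ω)
    (hθ : ContDiff ℝ 1 θ) (htw : Twisted θ ω) :
    ∃ γ > 0, ∀ s, 0 ≤ s → ∀ v, IsTest3 (Omega0 ω) v →
      (1 / 4 + γ) * ∫ z, ‖v z‖ ^ 2 ≤ Jform θ ω s v := by
  obtain ⟨α, B, x₀, r, hB, hr, hsub, hang, hZ0⟩ := htw.exists_angle hθ.continuous hω hbdd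
  set Z := {q ∈ ω | rot α q ∉ ω} with hZ
  have hZm : MeasurableSet Z :=
    hω.measurableSet.inter (hω.preimage (continuous_rot α)).measurableSet.compl
  obtain ⟨C, hC, hgap⟩ := exists_complex_gap hω hbdd hconn hZm (fun q hq => hq.1) hZ0
  set G := Real.exp (B ^ 2 / 4) with hG
  have hG0 : 0 < G := Real.exp_pos _
  set K := B / r * (2 * G) * (C * (1 + 4 * B * G * r)) + 8 * B ^ 2 * G with hK
  have hK0 : 0 < K := by positivity
  refine ⟨1 / 5 / (1 + (1 / 5 + 2 / B ^ 2) * K), by positivity, fun s hs v hv => ?_⟩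
  set R := Real.exp (s / 2) with hR
  have hR1 : 1 ≤ R := Real.one_le_exp (by positivity)
  have hR0 : 0 < R := by positivity
  have hR2 : R ^ 2 = Real.exp s := by
    rw [hR, ← Real.exp_nat_mul]; push_cast; congr 1; ring
  have ha := continuous_twist_angle hθ s
  have hu := hv.isProfile hθ s
  set Φ := rotHomeomorph ha with hΦ
  have hfib : ∀ y, ∫ p, ‖v (Φ (y, p))‖ ^ 2 = ∫ p, ‖v (y, p)‖ ^ 2 := fun y =>
    integral_comp_rot (-θ (R * y)) fun p => ‖v (y, p)‖ ^ 2
  set e : ℝ × ℝ → ℝ := fun p => ∫ y in Icc (-(B / R)) (B / R),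
    ‖twistedDeriv θ s v (Φ (y, p)) + (y / 4) • v (Φ (y, p))‖ ^ 2 with he
  have ei : Integrable e := hu.integrable_fiber_energy (B / R)
  have e0 : ∀ p, 0 ≤ e p := fun p => integral_nonneg fun y => by positivity
  have hmemL : ∀ y, R * y ∈ Icc (-B) B → y ∈ Icc (-(B / R)) (B / R) := fun y hy => by
    rw [mem_Icc] at hy ⊢
    rwa [← neg_div, div_le_iff₀ hR0, le_div_iff₀ hR0, mul_comm y]
  have key := hu.lower_bound hv.integrable_fiberExcess hv.fiberExcess_nonneg hR1 hB hr hG hC hK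
    hsub rfl fun y hy => by
      obtain ⟨t, ht, htα⟩ := hang _ hy
      have htR : R * (t / R) = t := by field_simp
      have h1 := hgap _ (hv.isTest2_fiber y)
      have h2 : ∀ q ∈ Z, ‖v (y, q)‖ ^ 2 ≤ 2 * (B / R) * G * e (rot (θ (R * y)) q) := by
        intro q hq
        have h3 : v (Φ (t / R, rot (θ (R * y)) q)) = 0 := by
          have e3 : Φ (t / R, rot (θ (R * y)) q) = (t / R, rot α q) := by
            have : Φ (t / R, rot (θ (R * y)) q) =
              (t / R, rot (-θ (R * (t / R))) (rot (θ (R * y)) q)) := rfl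
            rw [this, rot_rot, htR, ← htα, neg_add_eq_sub]
          rw [e3]
          exact hv.eq_zero hq.2
        have h4 : v (Φ (y, rot (θ (R * y)) q)) = v (y, q) := by
          have : Φ (y, rot (θ (R * y)) q) = (y, rot (-θ (R * y)) (rot (θ (R * y)) q)) := rfl
          rw [this, rot_neg_rot]
        have h5 := hu.norm_sq_le_of_eq_zero (div_le_self hB.le hR1) (hmemL y (hsub hy))
          (hmemL (t / R) (htR.symm ▸ ht)) h3
        rw [← h4]
        exact h5
      have ei2 : Integrable fun q => 2 * (B / R) * G * e (rot (θ (R * y)) q) :=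
        ((measurePreserving_rot (θ (R * y))).integrable_comp_of_integrable ei).const_mul _
      have h6 : ∫ q in Z, ‖v (y, q)‖ ^ 2 ≤ 2 * (B / R) * G * ∫ p, e p := by
        calc ∫ q in Z, ‖v (y, q)‖ ^ 2
            ≤ ∫ q in Z, 2 * (B / R) * G * e (rot (θ (R * y)) q) :=
              setIntegral_mono_on (hv.isTest2_fiber y).integrable_sq.integrableOn
                ei2.integrableOn hZm h2
          _ ≤ ∫ q, 2 * (B / R) * G * e (rot (θ (R * y)) q) :=
              setIntegral_le_integral ei2 (Eventually.of_forall fun q =>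
                mul_nonneg (by positivity) (e0 _))
          _ = _ := by rw [integral_const_mul, integral_comp_rot _ e]
      refine (hfib y).trans_le (h1.trans ?_)
      gcongr
      · exact le_rfl
  have gs := hu.integral_ground_state
  have t1 : ∫ z, ‖twistedDeriv θ s v (Φ z)‖ ^ 2 = ∫ z, ‖twistedDeriv θ s v z‖ ^ 2 :=
    integral_comp_rotHomeomorph ha (F := fun z => ‖twistedDeriv θ s v z‖ ^ 2)
      ((hv.continuous_twistedDeriv hθ s).norm.pow 2)
      ((hv.hasCompactSupport_twistedDeriv (θ := θ) s).mono fun z hz h0 => hz (by simp [h0]))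
  have t2 : ∫ z : ℝ × ℝ × ℝ, z.1 ^ 2 * ‖v (Φ z)‖ ^ 2 = ∫ z : ℝ × ℝ × ℝ, z.1 ^ 2 * ‖v z‖ ^ 2 :=
    integral_comp_rotHomeomorph ha (F := fun z => z.1 ^ 2 * ‖v z‖ ^ 2)
      ((continuous_fst.pow 2).mul (hv.continuous.norm.pow 2))
      (hv.2.1.mono fun z hz h0 => hz (by simp [h0]))
  have t3 : ∫ z, ‖v (Φ z)‖ ^ 2 = ∫ z, ‖v z‖ ^ 2 :=
    integral_comp_rotHomeomorph ha (F := fun z => ‖v z‖ ^ 2)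
      (hv.continuous.norm.pow 2) hv.hasCompactSupport_sq
  rw [t1, t2, t3] at gs
  rw [t3, hR2] at key
  rw [hv.Jform_eq]
  linarith

end Untwist

/-- in a twisted tube with compactly supported θ̇,
inf_{s ∈ [0,∞)} μ(s) > 1/4, i.e. γ = inf_{s≥0} μ(s) − 1/4 is strictly positive. -/
theorem inf_mu_gt_quarter
    (ω : Set (ℝ × ℝ)) (hω_open : IsOpen ω) (hω_bdd : Bornology.IsBounded ω)
    (hω_conn : IsConnected ω)
    (θ : ℝ → ℝ) (hθ : ContDiff ℝ 1 θ) (hθ' : ∃ M : ℝ, ∀ t : ℝ, |deriv θ t| ≤ M)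
    (hsupp : HasCompactSupport (deriv θ))
    (htw : Twisted θ ω) :
    1 / 4 < sInf (mu θ ω '' Set.Ici 0) := by
  obtain ⟨γ, hγ, hJ⟩ := exists_Jform_ge hω_open hω_bdd hω_conn.isPreconnected hθ htw
  obtain ⟨v₀, hv₀, hne₀⟩ := exists_isTest3_ne_zero hω_open hω_conn.nonempty
  have hmu : ∀ s, 0 ≤ s → 1 / 4 + γ ≤ mu θ ω s := by
    intro s hs
    refine le_csInf ⟨_, v₀, hv₀, hne₀, rfl⟩ ?_
    rintro _ ⟨v, hv, hne, rfl⟩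
    rw [setIntegral_Omega0_eq (F := fun z => ‖v z‖ ^ 2) fun z hz => by simp [hv.eq_zero hz],
      le_div_iff₀ (hv.integral_sq_pos hne)]
    exact hJ s hs v hv
  have : 1 / 4 + γ ≤ sInf (mu θ ω '' Set.Ici 0) := by
    refine le_csInf ⟨_, 0, Set.mem_Ici.2 le_rfl, rfl⟩ ?_
    rintro _ ⟨s, hs, rfl⟩
    exact hmu s hs
  linarith
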